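/- For every integer n ≥ 2 there exists a nonlinearizable periodic holomorphic automorphism of ℂ^{n+2} of period n: a holomorphic automorphism F of ℂ^{n+2} such that the n-th iterate F^{∘n} is the identity, F^{∘m} is not the identity for 1 ≤ m < n, and there is no holomorphic automorphism ψ of ℂ^{n+2} and no invertible ℂ-linear map L of ℂ^{n+2} with F = ψ⁻¹ ∘ L ∘ ψ. In particular (n = 2), there is a nonlinearizable holomorphic involution on ℂ⁴. -/

import Mathlib

noncomputable section

/-- A holomorphic automorphism of ℂᴺ: a bijective entire map with entire inverse. -/
def IsHolomorphicAutomorphism {N : ℕ}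
    (F : EuclideanSpace ℂ (Fin N) → EuclideanSpace ℂ (Fin N)) : Prop :=
  Differentiable ℂ F ∧ ∃ G : EuclideanSpace ℂ (Fin N) → EuclideanSpace ℂ (Fin N),
    Differentiable ℂ G ∧ (∀ z, G (F z) = z) ∧ (∀ z, F (G z) = z)

section

open Set Filter Topology Metric

section Entire

variable {E G : Type*} [NormedAddCommGroup E] [NormedSpace ℂ E]
  [NormedAddCommGroup G] [NormedSpace ℂ G]

theorem norm_fderiv_le_of_closedBall {F : E → G} (hF : Differentiable ℂ F) {z : E} {s M : ℝ}
    (hs : 0 < s) (hM : ∀ x ∈ closedBall z s, ‖F x‖ ≤ M) : ‖fderiv ℂ F z‖ ≤ M / s := by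
  have hM0 : 0 ≤ M := (norm_nonneg _).trans (hM z (mem_closedBall_self hs.le))
  refine ContinuousLinearMap.opNorm_le_bound _ (by positivity) fun v => ?_
  rcases eq_or_ne v 0 with rfl | hv
  · simp
  have hv' : 0 < ‖v‖ := norm_pos_iff.2 hv
  have hline : Differentiable ℂ fun ζ : ℂ => F (z + ζ • v) := by fun_prop
  have hder : HasDerivAt (fun ζ : ℂ => F (z + ζ • v)) (fderiv ℂ F z v) 0 := by
    have h1 : HasDerivAt (fun ζ : ℂ => z + ζ • v) v 0 := by
      simpa using ((hasDerivAt_id (0 : ℂ)).smul_const v).const_add z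
    have h2 : HasFDerivAt F (fderiv ℂ F z) (z + (0 : ℂ) • v) := by
      simpa using (hF z).hasFDerivAt
    exact h2.comp_hasDerivAt 0 h1
  have h3 := Complex.norm_deriv_le_of_forall_mem_sphere_norm_le (c := 0) (R := s / ‖v‖) (C := M)
    (by positivity) hline.diffContOnCl (fun ζ hζ => hM _ (by
      rw [mem_sphere_zero_iff_norm] at hζ
      simp [norm_smul, hζ, hv'.ne']))
  rw [hder.deriv] at h3
  calc _ ≤ M / (s / ‖v‖) := h3
    _ = M / s * ‖v‖ := by field_simp

theorem norm_sub_le_of_closedBall {F : E → G} (hF : Differentiable ℂ F) {z : E} {r s M : ℝ}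
    (hs : 0 < s) (hM : ∀ x ∈ closedBall z (r + s), ‖F x‖ ≤ M) {x y : E}
    (hx : x ∈ closedBall z r) (hy : y ∈ closedBall z r) : ‖F y - F x‖ ≤ M / s * ‖y - x‖ := by
  refine (convex_closedBall z r).norm_image_sub_le_of_norm_fderiv_le (𝕜 := ℂ) (fun w _ => hF w)
    (fun w hw => norm_fderiv_le_of_closedBall hF hs fun u hu => hM u ?_) hx hy
  rw [mem_closedBall] at *
  linarith [dist_triangle u w z]

theorem norm_fderiv_sub_le_of_closedBall {F : E → G} (hF : Differentiable ℂ F) {z : E}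
    {r s M : ℝ} (hs : 0 < s) (hM : ∀ x ∈ closedBall z (r + s + s), ‖F x‖ ≤ M) {x y : E}
    (hx : x ∈ closedBall z r) (hy : y ∈ closedBall z r) :
    ‖fderiv ℂ F y - fderiv ℂ F x‖ ≤ M / s * ‖y - x‖ / s := by
  have hd : Differentiable ℂ fun w => F (w + (y - x)) - F w := by fun_prop
  have key := norm_fderiv_le_of_closedBall hd (z := x) hs (M := M / s * ‖y - x‖) ?_
  · have h1 : fderiv ℂ (fun w => F (w + (y - x)) - F w) x = fderiv ℂ F y - fderiv ℂ F x := by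
      have h2 : HasFDerivAt (fun w => F (w + (y - x))) (fderiv ℂ F y) x := by
        rw [hasFDerivAt_comp_add_right, add_sub_cancel]; exact (hF y).hasFDerivAt
      exact (h2.sub (hF x).hasFDerivAt).fderiv
    rwa [h1] at key
  · intro w hw
    have := norm_sub_le_of_closedBall hF hs hM (x := w) (y := w + (y - x)) ?_ ?_
    · simpa using this
    · rw [mem_closedBall] at *
      linarith [dist_triangle w x z]
    · rw [mem_closedBall, dist_eq_norm] at *
      have : w + (y - x) - z = (w - x) + (y - z) := by abel
      rw [this]
      linarith [norm_add_le (w - x) (y - z)]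

theorem exists_norm_le_of_continuous {X Y : Type*} [NormedAddCommGroup X] [ProperSpace X]
    [NormedAddCommGroup Y] {F : X → Y} (hF : Continuous F) (r : ℝ) :
    ∃ M, 0 < M ∧ ∀ x ∈ closedBall (0 : X) r, ‖F x‖ ≤ M := by
  obtain ⟨M, hM⟩ := (isCompact_closedBall (0 : X) r).exists_bound_of_continuousOn hF.continuousOn
  exact ⟨max M 1, by positivity, fun x hx => (hM x hx).trans (le_max_left _ _)⟩

theorem Differentiable.continuous_fderiv_complex [ProperSpace E] {F : E → G}
    (hF : Differentiable ℂ F) : Continuous (fderiv ℂ F) := by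
  rw [continuous_iff_continuousAt]
  intro z
  obtain ⟨M, hM0, hM⟩ := exists_norm_le_of_continuous hF.continuous (‖z‖ + 1 + 1 + 1)
  refine continuousAt_of_locally_lipschitz one_pos M fun y hy => ?_
  have := norm_fderiv_sub_le_of_closedBall hF (z := z) (r := 1) one_pos (M := M)
    (fun x hx => hM x ?_)
    (x := z) (y := y) (by simp) (by simpa using hy.le)
  · simpa [dist_eq_norm] using this
  · rw [mem_closedBall, dist_eq_norm] at *
    have := norm_sub_norm_le x z
    simp; linarith

theorem differentiable_of_tendstoUniformlyOn_closedBall [CompleteSpace G] {F : ℕ → E → G}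
    {f : E → G} (hF : ∀ n, Differentiable ℂ (F n))
    (h : ∀ R : ℝ, TendstoUniformlyOn F f atTop (closedBall 0 R)) :
    Differentiable ℂ f ∧
      ∀ R : ℝ, TendstoUniformlyOn (fun n => fderiv ℂ (F n)) (fderiv ℂ f) atTop
        (closedBall 0 R) := by
  have hc : ∀ R : ℝ, UniformCauchySeqOn (fun n => fderiv ℂ (F n)) atTop (closedBall 0 R) := by
    intro R
    rw [Metric.uniformCauchySeqOn_iff]
    intro ε hε
    obtain ⟨N, hN⟩ := Metric.uniformCauchySeqOn_iff.1 (h (R + 1)).uniformCauchySeqOn (ε / 2)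
      (by positivity)
    refine ⟨N, fun m hm n hn x hx => ?_⟩
    have h1 := norm_fderiv_le_of_closedBall ((hF m).sub (hF n)) (z := x) one_pos (M := ε / 2) ?_
    · rw [fderiv_sub (hF m x) (hF n x), div_one] at h1
      rw [dist_eq_norm]
      linarith
    · intro y hy
      have := hN m hm n hn y (by
        rw [mem_closedBall] at *
        linarith [dist_triangle y x 0])
      rw [dist_eq_norm] at this
      exact this.le
  have hlim : ∀ x, ∃ g, Tendsto (fun n => fderiv ℂ (F n) x) atTop (𝓝 g) := fun x =>
    cauchySeq_tendsto_of_complete ((hc ‖x‖).cauchySeq (by simp))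
  choose g hg using hlim
  have hu : ∀ R : ℝ, TendstoUniformlyOn (fun n => fderiv ℂ (F n)) g atTop (closedBall 0 R) :=
    fun R => (hc R).tendstoUniformlyOn_of_tendsto fun x _ => hg x
  have hd : ∀ x, HasFDerivAt f (g x) x := fun x =>
    hasFDerivAt_of_tendstoUniformlyOn (s := ball 0 (‖x‖ + 1)) isOpen_ball
      ((hu (‖x‖ + 1)).mono ball_subset_closedBall) (fun n y _ => (hF n y).hasFDerivAt)
      (fun y hy => (h (‖x‖ + 1)).tendsto_at (ball_subset_closedBall hy)) (by simp)
  refine ⟨fun x => (hd x).differentiableAt, fun R => ?_⟩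
  have : fderiv ℂ f = g := funext fun x => (hd x).fderiv
  rw [this]; exact hu R

theorem Differentiable.fderiv_apply_complex [ProperSpace E] [CompleteSpace G] {F : E → G}
    (hF : Differentiable ℂ F) : Differentiable ℂ fun p : E × E => fderiv ℂ F p.1 p.2 := by
  let h : ℕ → ℂ := fun n => 1 / ((n : ℂ) + 1)
  have hnorm : ∀ n, ‖h n‖ = 1 / ((n : ℝ) + 1) := fun n => by
    simp only [h, norm_div, norm_one]
    congr 1
    exact_mod_cast Complex.norm_natCast (n + 1)
  have hne : ∀ n, h n ≠ 0 := fun n => by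
    rw [← norm_pos_iff, hnorm]; positivity
  refine (differentiable_of_tendstoUniformlyOn_closedBall
    (F := fun n p => (h n)⁻¹ • (F (p.1 + h n • p.2) - F p.1)) (fun n => by fun_prop) ?_).1
  intro R
  obtain ⟨M, hM0, hM⟩ := exists_norm_le_of_continuous hF.continuous ((R + R) + 1 + 1)
  rw [Metric.tendstoUniformlyOn_iff]
  intro ε hε
  have hev : ∀ᶠ n : ℕ in atTop, 1 / ((n : ℝ) + 1) * (M * |R| * |R|) < ε := by
    have := tendsto_one_div_add_atTop_nhds_zero_nat (𝕜 := ℝ)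
    have := this.mul_const (M * |R| * |R|)
    rw [zero_mul] at this
    exact this.eventually (gt_mem_nhds hε)
  filter_upwards [hev] with n hn p hp
  have hp' := mem_closedBall_zero_iff.1 hp
  have hR : 0 ≤ R := (norm_nonneg _).trans hp'
  have hp1 : ‖p.1‖ ≤ R := (norm_fst_le p).trans hp'
  have hp2 : ‖p.2‖ ≤ R := (norm_snd_le p).trans hp'
  have hle1 : 1 / ((n : ℝ) + 1) ≤ 1 := by
    rw [div_le_one (by positivity)]; linarith [(Nat.cast_nonneg n : (0 : ℝ) ≤ n)]
  have hb : ∀ w ∈ segment ℝ p.1 (p.1 + h n • p.2), ‖fderiv ℂ F w - fderiv ℂ F p.1‖ ≤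
      M * (1 / ((n : ℝ) + 1) * R) := by
    intro w hw
    have hw1 : ‖w - p.1‖ ≤ 1 / ((n : ℝ) + 1) * R := by
      have := norm_sub_le_of_mem_segment hw
      simp only [add_sub_cancel_left, norm_smul, hnorm] at this
      exact this.trans (by gcongr)
    have := norm_fderiv_sub_le_of_closedBall hF (z := 0) (r := R + R) one_pos hM (x := p.1) (y := w)
      (by simp; linarith) (by
        simp only [mem_closedBall_zero_iff]
        have h1 := norm_le_norm_add_norm_sub p.1 w
        rw [norm_sub_rev] at h1
        have h2 : 1 / ((n : ℝ) + 1) * R ≤ 1 * R := by gcongr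
        linarith)
    simp only [div_one] at this
    exact this.trans (by gcongr)
  have key := (convex_segment p.1 (p.1 + h n • p.2)).norm_image_sub_le_of_norm_fderiv_le' (𝕜 := ℂ)
    (fun w _ => hF w) hb (left_mem_segment _ _ _) (right_mem_segment _ _ _)
  rw [add_sub_cancel_left, map_smul, norm_smul, hnorm] at key
  rw [dist_comm, dist_eq_norm]
  have h4 : (h n)⁻¹ • (F (p.1 + h n • p.2) - F p.1) - fderiv ℂ F p.1 p.2 =
      (h n)⁻¹ • (F (p.1 + h n • p.2) - F p.1 - h n • fderiv ℂ F p.1 p.2) := by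
    rw [smul_sub _ (_ - _), inv_smul_smul₀ (hne n)]
  rw [h4, norm_smul, norm_inv, hnorm]
  have h5 : (0 : ℝ) < 1 / ((n : ℝ) + 1) := by positivity
  rw [inv_mul_lt_iff₀ h5]
  rw [abs_of_nonneg hR] at hn
  calc _ ≤ _ := key
    _ ≤ M * (1 / ((n : ℝ) + 1) * R) * (1 / ((n : ℝ) + 1) * R) := by gcongr
    _ = 1 / ((n : ℝ) + 1) * (1 / ((n : ℝ) + 1) * (M * R * R)) := by ring
    _ < _ := by gcongr

theorem differentiable_integral_of_differentiable [ProperSpace E] [CompleteSpace G]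
    {H : E × ℂ → G} (hH : Differentiable ℂ H) :
    Differentiable ℂ fun x => ∫ t in (0 : ℝ)..1, H (x, (t : ℂ)) := by
  intro x₀
  have hc := hH.continuous_fderiv_complex
  obtain ⟨M, hM0, hM⟩ := exists_norm_le_of_continuous hc (max (‖x₀‖ + 1) 1)
  have hcont : ∀ x, Continuous fun t : ℝ => H (x, (t : ℂ)) := fun x =>
    hH.continuous.comp (by fun_prop)
  refine (intervalIntegral.hasFDerivAt_integral_of_dominated_of_fderiv_le
    (F := fun x (t : ℝ) => H (x, (t : ℂ)))
    (F' := fun x (t : ℝ) => (fderiv ℂ H (x, (t : ℂ))).comp (ContinuousLinearMap.inl ℂ E ℂ))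
    (s := ball x₀ 1) (bound := fun _ => M * 1) (ball_mem_nhds x₀ one_pos)
    (Eventually.of_forall fun x => (hcont x).aestronglyMeasurable)
    ((hcont x₀).intervalIntegrable _ _) ?_ ?_ (by simp) ?_).differentiableAt
  · refine Continuous.aestronglyMeasurable ?_
    have : Continuous fun t : ℝ => fderiv ℂ H (x₀, (t : ℂ)) := hc.comp (by fun_prop)
    exact this.clm_comp continuous_const
  · refine Eventually.of_forall fun t ht x hx => ?_
    rw [uIoc_of_le zero_le_one] at ht
    refine (ContinuousLinearMap.opNorm_comp_le _ _).trans ?_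
    gcongr
    · refine hM _ ?_
      rw [mem_closedBall_zero_iff, Prod.norm_def]
      refine max_le_max ?_ ?_
      · have := norm_le_norm_add_norm_sub x₀ x
        rw [mem_ball, dist_eq_norm] at hx
        rw [norm_sub_rev] at this
        simp; linarith
      · simp [abs_of_pos ht.1, ht.2]
    · exact ContinuousLinearMap.norm_inl_le_one ℂ E ℂ
  · refine Eventually.of_forall fun t _ x _ => ?_
    have h1 : HasFDerivAt (fun x : E => (x, (t : ℂ))) (ContinuousLinearMap.inl ℂ E ℂ) x :=
      hasFDerivAt_prodMk_left x (t : ℂ)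
    exact ((hH (x, (t : ℂ))).hasFDerivAt).comp x h1

theorem exists_differentiable_quotient [ProperSpace E] [CompleteSpace G] {g : E → G}
    (hg : Differentiable ℂ g) : ∃ q : E × E × ℂ → G, Differentiable ℂ q ∧
      ∀ z ζ l, g (z + l • ζ) = g z + l • q (z, ζ, l) := by
  refine ⟨fun p => ∫ t in (0 : ℝ)..1, fderiv ℂ g (p.1 + ((t : ℂ) * p.2.2) • p.2.1) p.2.1, ?_, ?_⟩
  · refine differentiable_integral_of_differentiable (E := E × E × ℂ)
      (H := fun p => fderiv ℂ g (p.1.1 + (p.2 * p.1.2.2) • p.1.2.1) p.1.2.1) ?_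
    exact hg.fderiv_apply_complex.comp
      (g := fun p : E × E => fderiv ℂ g p.1 p.2)
      (f := fun p : (E × E × ℂ) × ℂ => (p.1.1 + (p.2 * p.1.2.2) • p.1.2.1, p.1.2.1))
      (by fun_prop)
  · intro z ζ l
    have hd : ∀ t : ℝ, HasDerivAt (fun t : ℝ => g (z + ((t : ℂ) * l) • ζ))
        (l • fderiv ℂ g (z + ((t : ℂ) * l) • ζ) ζ) t := by
      intro t
      have h1 : HasDerivAt (fun t : ℂ => z + (t * l) • ζ) (l • ζ) (t : ℂ) := by
        have := (((hasDerivAt_id (t : ℂ)).mul_const l).smul_const ζ).const_add z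
        simpa using this
      have h2 := HasFDerivAt.comp_hasDerivAt (f := fun t : ℂ => z + (t * l) • ζ) (t : ℂ)
        (hg (z + ((t : ℂ) * l) • ζ)).hasFDerivAt h1
      replace h2 := HasDerivAt.scomp t h2 Complex.ofRealCLM.hasDerivAt
      simpa [Function.comp_def] using h2
    have hcont : Continuous fun t : ℝ => l • fderiv ℂ g (z + ((t : ℂ) * l) • ζ) ζ := by
      have := hg.continuous_fderiv_complex
      have h2 : Continuous fun t : ℝ => fderiv ℂ g (z + ((t : ℂ) * l) • ζ) :=
        this.comp (by fun_prop)
      exact (h2.clm_apply continuous_const).const_smul l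
    have := intervalIntegral.integral_eq_sub_of_hasDerivAt (fun t _ => hd t)
      (hcont.intervalIntegrable 0 1)
    rw [intervalIntegral.integral_smul] at this
    simp only [Complex.ofReal_one, one_mul, Complex.ofReal_zero, zero_mul, zero_smul,
      add_zero] at this
    rw [this]; abel

end Entire

theorem countable_setOf_eq_zero {f : ℂ → ℂ} (hf : Differentiable ℂ f) {z₀ : ℂ} (h0 : f z₀ ≠ 0) :
    {z | f z = 0}.Countable := by
  have hA : AnalyticOnNhd ℂ f univ := hf.differentiableOn.analyticOnNhd isOpen_univ
  have hd : DiscreteTopology {z | f z = 0} := by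
    rw [discreteTopology_subtype_iff]
    intro x hx
    by_contra hne
    refine h0 (hA.eqOn_zero_of_preconnected_of_frequently_eq_zero isPreconnected_univ
      (mem_univ x) ?_ (mem_univ z₀))
    intro hev
    refine hne ?_
    rw [← disjoint_iff, Filter.disjoint_iff]
    exact ⟨_, hev, _, mem_principal_self _, disjoint_left.2 fun y hy hy' => hy hy'⟩
  exact countable_of_Lindelof_of_discrete (X := {z | f z = 0})

theorem exists_norm_gt_of_countable {S : Set ℂ} (hS : S.Countable) (a : ℝ) :
    ∃ r, a < r ∧ ∀ z ∈ S, ‖z‖ ≠ r := by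
  obtain ⟨r, hr, hr'⟩ := ((hS.image norm).dense_compl ℝ).inter_open_nonempty (Ioi a) isOpen_Ioi
    nonempty_Ioi
  exact ⟨r, hr, fun z hz h => hr' ⟨z, hz, h⟩⟩

section

variable {E G : Type*} [NormedAddCommGroup E] [NormedSpace ℂ E]
  [NormedAddCommGroup G] [NormedSpace ℂ G]

theorem exists_quotient_of_tendsto [ProperSpace E] [CompleteSpace G] {f : ℕ → E → ℂ}
    {k N : ℕ → E → G} {f' : E → ℂ} {N' : E → G} (hf : ∀ n, Differentiable ℂ (f n))
    (hk : ∀ n, Differentiable ℂ (k n)) (hN : ∀ n z, N n z = f n z • k n z)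
    (hff : ∀ R : ℝ, TendstoUniformlyOn f f' atTop (closedBall 0 R))
    (hNN : ∀ R : ℝ, TendstoUniformlyOn N N' atTop (closedBall 0 R)) (h0 : f' 0 ≠ 0) :
    ∃ k' : E → G, Differentiable ℂ k' ∧ ∀ z, N' z = f' z • k' z := by
  have hf' : Differentiable ℂ f' := (differentiable_of_tendstoUniformlyOn_closedBall hf hff).1
  have hloc : ∀ z₀ : E, ∃ U ∈ 𝓝 z₀, UniformCauchySeqOn k atTop U := by
    intro z₀
    have hline : Differentiable ℂ fun ζ : ℂ => f' (ζ • z₀) := by fun_prop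
    obtain ⟨r, hr, hz⟩ := exists_norm_gt_of_countable
      (countable_setOf_eq_zero hline (z₀ := 0) (by simpa using h0)) 1
    have hr0 : 0 < r := one_pos.trans hr
    obtain ⟨c, hc0, hc⟩ : ∃ c > 0, ∀ ζ ∈ sphere (0 : ℂ) r, c < ‖f' (ζ • z₀)‖ := by
      obtain ⟨ζ₁, h1, h2⟩ := (isCompact_sphere (0 : ℂ) r).exists_isMinOn
        (NormedSpace.sphere_nonempty.2 hr0.le) (f := fun ζ => ‖f' (ζ • z₀)‖)
        (hline.continuous.norm.continuousOn)
      have hp : 0 < ‖f' (ζ₁ • z₀)‖ := by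
        rw [norm_pos_iff]
        intro h
        exact hz ζ₁ h (by simpa using h1)
      refine ⟨‖f' (ζ₁ • z₀)‖ / 2, by positivity, fun ζ hζ => ?_⟩
      have : ‖f' (ζ₁ • z₀)‖ ≤ ‖f' (ζ • z₀)‖ := h2 hζ
      linarith
    have hev : ∀ᶠ z in 𝓝 z₀, ∀ ζ ∈ sphere (0 : ℂ) r, c < ‖f' (ζ • z)‖ := by
      refine (isCompact_sphere (0 : ℂ) r).eventually_forall_of_forall_eventually fun ζ hζ => ?_
      have hcont : Continuous fun p : E × ℂ => ‖f' (p.2 • p.1)‖ :=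
        (hf'.continuous.comp (by fun_prop)).norm
      exact hcont.continuousAt.eventually (lt_mem_nhds (hc ζ hζ))
    refine ⟨_, inter_mem hev (ball_mem_nhds z₀ one_pos), ?_⟩
    set R := r * (‖z₀‖ + 1) with hR
    obtain ⟨M, hM0, hM⟩ : ∃ M, 0 < M ∧ ∀ᶠ n in atTop, ∀ x ∈ closedBall (0 : E) R, ‖N n x‖ ≤ M := by
      have hNc : ∀ n, Continuous (N n) := fun n => by
        rw [funext (hN n)]; exact (hf n).continuous.smul (hk n).continuous
      have hN'c : ContinuousOn N' (closedBall 0 R) :=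
        (hNN R).continuousOn (Eventually.of_forall fun n => (hNc n).continuousOn).frequently
      obtain ⟨M, hM⟩ := (isCompact_closedBall (0 : E) R).exists_bound_of_continuousOn hN'c
      refine ⟨|M| + 1, by positivity, ?_⟩
      filter_upwards [Metric.tendstoUniformlyOn_iff.1 (hNN R) 1 one_pos] with n hn x hx
      have h1 := hn x hx
      have h2 := hM x hx
      rw [dist_eq_norm, norm_sub_rev] at h1
      have h3 := norm_le_norm_add_norm_sub (N' x) (N n x)
      rw [norm_sub_rev] at h1
      linarith [le_abs_self M]
    rw [Metric.uniformCauchySeqOn_iff]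
    intro ε hε
    set η := min (ε * c / 16) (ε * c ^ 2 / (16 * M)) with hη
    have hη0 : 0 < η := by positivity
    obtain ⟨n1, hn1⟩ := eventually_atTop.1 (Metric.tendstoUniformlyOn_iff.1 (hff R) (c / 2)
      (by positivity))
    obtain ⟨n2, hn2⟩ := Metric.uniformCauchySeqOn_iff.1 (hff R).uniformCauchySeqOn η hη0
    obtain ⟨n3, hn3⟩ := Metric.uniformCauchySeqOn_iff.1 (hNN R).uniformCauchySeqOn η hη0
    obtain ⟨n4, hn4⟩ := eventually_atTop.1 hM
    refine ⟨max (max n1 n2) (max n3 n4), fun m hm n hn z hz => ?_⟩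
    simp only [max_le_iff, ge_iff_le] at hm hn
    have hd : Differentiable ℂ fun ζ : ℂ => k m (ζ • z) - k n (ζ • z) := by
      have := hk m
      have := hk n
      fun_prop
    have hb : ∀ ζ ∈ frontier (ball (0 : ℂ) r), ‖k m (ζ • z) - k n (ζ • z)‖ ≤ ε / 2 := by
      intro ζ hζ
      rw [frontier_ball _ hr0.ne'] at hζ
      have hw : ζ • z ∈ closedBall (0 : E) R := by
        rw [mem_closedBall_zero_iff, norm_smul, mem_sphere_zero_iff_norm.1 hζ, hR]
        gcongr
        have h1 := hz.2
        rw [mem_ball, dist_eq_norm] at h1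
        have := norm_le_norm_add_norm_sub' z z₀
        linarith
      have hcz : c < ‖f' (ζ • z)‖ := hz.1 ζ hζ
      set w := ζ • z
      have hlow : ∀ i ≥ n1, c / 2 ≤ ‖f i w‖ := fun i hi => by
        have h1 := hn1 i hi w hw
        rw [dist_eq_norm] at h1
        have := norm_le_norm_add_norm_sub' (f' w) (f i w)
        linarith
      have hm1 := hlow m hm.1.1
      have hn1' := hlow n hn.1.1
      have hmpos : 0 < ‖f m w‖ := by linarith
      have hnpos : 0 < ‖f n w‖ := by linarith
      have hfd : ‖f m w - f n w‖ ≤ η := by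
        have := hn2 m hm.1.2 n hn.1.2 w hw
        rw [dist_eq_norm] at this; exact this.le
      have hNd : ‖N m w - N n w‖ ≤ η := by
        have := hn3 m hm.2.1 n hn.2.1 w hw
        rw [dist_eq_norm] at this; exact this.le
      have hNb : ‖N n w‖ ≤ M := hn4 n hn.2.2 w hw
      have hkn : ‖k n w‖ ≤ M / (c / 2) := by
        rw [le_div_iff₀ (by positivity)]
        rw [hN, norm_smul] at hNb
        nlinarith [norm_nonneg (k n w)]
      have hid : f m w • (k m w - k n w) = (N m w - N n w) - (f m w - f n w) • k n w := by
        rw [hN, hN, smul_sub, sub_smul]; abel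
      have h5 : ‖f m w‖ * ‖k m w - k n w‖ ≤ η + η * (M / (c / 2)) := by
        rw [← norm_smul, hid]
        refine (norm_sub_le _ _).trans ?_
        rw [norm_smul]
        gcongr
      have h6 : η ≤ ε * c / 16 := min_le_left _ _
      have h7 : η * (M / (c / 2)) ≤ ε * c / 8 := by
        calc _ ≤ (ε * c ^ 2 / (16 * M)) * (M / (c / 2)) := by
              gcongr; exact min_le_right _ _
          _ = ε * c / 8 := by field_simp; norm_num
      have h8 : c / 2 * ‖k m w - k n w‖ ≤ ‖f m w‖ * ‖k m w - k n w‖ := by gcongr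
      have h9 : c / 2 * ‖k m w - k n w‖ ≤ c / 2 * (ε / 2) := by nlinarith [mul_pos hε hc0]
      exact le_of_mul_le_mul_left h9 (by positivity)
    have := Complex.norm_le_of_forall_mem_frontier_norm_le isBounded_ball hd.diffContOnCl hb
      (z := 1) (subset_closure (by simpa using hr))
    simp only [one_smul] at this
    rw [dist_eq_norm]
    linarith
  have hlim : ∀ x, ∃ g, Tendsto (fun n => k n x) atTop (𝓝 g) := fun x => by
    obtain ⟨U, hU, h⟩ := hloc x
    exact cauchySeq_tendsto_of_complete (h.cauchySeq (mem_of_mem_nhds hU))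
  choose g hg using hlim
  have hu : ∀ R : ℝ, TendstoUniformlyOn k g atTop (closedBall 0 R) := by
    intro R
    rw [← tendstoLocallyUniformlyOn_iff_tendstoUniformlyOn_of_compact (isCompact_closedBall _ _)]
    refine TendstoLocallyUniformlyOn.mono ?_ (subset_univ _)
    rw [tendstoLocallyUniformlyOn_univ]
    intro u hu x
    obtain ⟨U, hU, h⟩ := hloc x
    exact ⟨U, hU, h.tendstoUniformlyOn_of_tendsto (fun x _ => hg x) u hu⟩
  refine ⟨g, (differentiable_of_tendstoUniformlyOn_closedBall hk hu).1, fun z => ?_⟩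
  have h1 : Tendsto (fun n => N n z) atTop (𝓝 (N' z)) := (hNN ‖z‖).tendsto_at (by simp)
  have h2 : Tendsto (fun n => f n z) atTop (𝓝 (f' z)) := (hff ‖z‖).tendsto_at (by simp)
  refine tendsto_nhds_unique h1 ?_
  simp only [hN]
  exact h2.smul (hg z)

end

theorem exists_norm_ge_near {a b M ρ : ℝ} (ha : 0 < a) (hab : a < b) (hρ : 0 < ρ) :
    ∃ δ > 0, ∀ j : ℂ → ℂ, Differentiable ℂ j → (∀ z ∈ closedBall (0 : ℂ) b, ‖j z‖ ≤ M) →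
      1 ≤ ‖j 0‖ → ∀ q, ‖q‖ ≤ a → ∃ ζ, ‖ζ - q‖ ≤ ρ ∧ δ ≤ ‖j ζ‖ := by
  have hb : 0 < b := ha.trans hab
  obtain ⟨k, hk⟩ := pow_unbounded_of_one_lt (max M 1) ((one_lt_div ha).2 hab)
  refine ⟨min 1 ((ρ / (2 * b)) ^ k), by positivity, fun j hj hjM hj0 q hq => ?_⟩
  by_contra! hcon
  have hqρ : ρ < ‖q‖ := by
    by_contra! h
    have := hcon 0 (by simpa using h)
    linarith [this.trans_le (min_le_left _ _)]
  set U := ball (0 : ℂ) b ∩ (closedBall q ρ)ᶜ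
  have hcl : closure (closedBall q ρ)ᶜ ⊆ {ζ | ρ ≤ ‖ζ - q‖} := by
    refine closure_minimal (fun ζ hζ => ?_) (isClosed_le continuous_const (by fun_prop))
    rw [mem_compl_iff, mem_closedBall, dist_eq_norm, not_le] at hζ
    exact hζ.le
  set g : ℂ → ℂ := fun ζ => j ζ * (((b : ℂ) ^ 2 - (starRingEnd ℂ) q * ζ) / (b * (ζ - q))) ^ k
  have hbC : (b : ℂ) ≠ 0 := by exact_mod_cast hb.ne'
  have hnz : ∀ ζ, ρ ≤ ‖ζ - q‖ → (b : ℂ) * (ζ - q) ≠ 0 := fun ζ h =>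
    mul_ne_zero hbC (norm_pos_iff.1 (hρ.trans_le h))
  have hd : DiffContOnCl ℂ g U := by
    refine DifferentiableOn.diffContOnCl fun ζ hζ => ?_
    have := hnz ζ (hcl (closure_mono inter_subset_right hζ))
    refine DifferentiableAt.differentiableWithinAt ?_
    refine (hj ζ).mul (DifferentiableAt.pow ?_ k)
    exact DifferentiableAt.div (by fun_prop) (by fun_prop) this
  have hfr : ∀ ζ ∈ frontier U, ‖g ζ‖ ≤ max M 1 := by
    intro ζ hζ
    rcases frontier_inter_subset _ _ hζ with ⟨h1, h2⟩ | ⟨h1, h2⟩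
    · rw [frontier_ball _ hb.ne', mem_sphere_zero_iff_norm] at h1
      have h3 : ‖((b : ℂ) ^ 2 - (starRingEnd ℂ) q * ζ) / (b * (ζ - q))‖ = 1 := by
        have h4 : (b : ℂ) ^ 2 = (starRingEnd ℂ) ζ * ζ := by
          rw [← Complex.normSq_eq_conj_mul_self, Complex.normSq_eq_norm_sq, h1]; push_cast; rfl
        rw [h4, ← sub_mul, ← map_sub, norm_div, norm_mul, norm_mul, h1, RCLike.norm_conj]
        have := norm_pos_iff.2 (hnz ζ (hcl h2))
        rw [norm_mul] at this
        have h5 : ‖(b : ℂ)‖ = b := by simp [hb.le]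
        rw [h5] at this ⊢
        rw [mul_comm]
        exact div_self this.ne'
      have h6 : ‖g ζ‖ = ‖j ζ‖ := by simp only [g, norm_mul, norm_pow, h3, one_pow, mul_one]
      rw [h6]
      exact (hjM ζ (by simp [h1])).trans (le_max_left _ _)
    · rw [frontier_compl, frontier_closedBall _ hρ.ne', mem_sphere, dist_eq_norm] at h2
      rw [closure_ball _ hb.ne', mem_closedBall_zero_iff] at h1
      have h3 : ‖((b : ℂ) ^ 2 - (starRingEnd ℂ) q * ζ) / (b * (ζ - q))‖ ≤ 2 * b / ρ := by
        have h5 : ‖(b : ℂ)‖ = b := by simp [hb.le]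
        rw [norm_div, norm_mul, h2, h5, div_le_div_iff₀ (by positivity) hρ]
        have h6 : ‖(b : ℂ) ^ 2 - (starRingEnd ℂ) q * ζ‖ ≤ b ^ 2 + a * b := by
          refine (norm_sub_le _ _).trans ?_
          rw [norm_pow, h5, norm_mul, RCLike.norm_conj]
          gcongr
        nlinarith [mul_pos hb hρ, mul_pos hb hb]
      have h4 := (hcon ζ h2.le).le.trans (min_le_right _ _)
      simp only [g, norm_mul, norm_pow]
      calc _ ≤ (ρ / (2 * b)) ^ k * (2 * b / ρ) ^ k := by gcongr
        _ = 1 := by rw [← mul_pow]; field_simp; simp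
        _ ≤ _ := le_max_right _ _
  have h0 : (0 : ℂ) ∈ U := ⟨by simpa using hb, by simpa using hqρ⟩
  have := Complex.norm_le_of_forall_mem_frontier_norm_le (isBounded_ball.subset inter_subset_left)
    hd hfr (subset_closure h0)
  have hg0 : ‖g 0‖ = ‖j 0‖ * (b / ‖q‖) ^ k := by
    have hq0 : ‖q‖ ≠ 0 := (hρ.trans hqρ).ne'
    simp only [g, norm_mul, norm_pow, norm_div, mul_zero, sub_zero, zero_sub, norm_neg,
      Complex.norm_real, Real.norm_eq_abs, abs_of_pos hb]
    congr 2
    field_simp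
  have h7 : (b / a) ^ k ≤ (b / ‖q‖) ^ k := by
    have : 0 < ‖q‖ := hρ.trans hqρ
    gcongr
  have h8 : 1 * (b / ‖q‖) ^ k ≤ ‖j 0‖ * (b / ‖q‖) ^ k := by gcongr
  linarith

theorem exists_eq_of_fderiv_near {E : Type*} [NormedAddCommGroup E] [NormedSpace ℂ E]
    [FiniteDimensional ℂ E] {F : E → E} (hF : Differentiable ℂ F) {p : E} {r C : ℝ}
    (hr : 0 < r) (hC : 0 < C) (e : E ≃L[ℂ] E) (he : ‖(e.symm : E →L[ℂ] E)‖ ≤ C)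
    (h : ∀ x ∈ closedBall p r, ‖fderiv ℂ F x - e‖ ≤ 1 / (2 * C)) {w : E}
    (hw : ‖w - F p‖ ≤ r / (2 * C)) :
    ∃ p' ∈ closedBall p r, F p' = w ∧ Function.Surjective (fderiv ℂ F p') := by
  have := FiniteDimensional.complete ℂ E
  rcases subsingleton_or_nontrivial E with hE | hE
  · exact ⟨p, mem_closedBall_self hr.le, Subsingleton.elim _ _, fun y => ⟨y, Subsingleton.elim _ _⟩⟩
  have hpos : 0 < ‖(e.symm : E →L[ℂ] E)‖ := e.norm_symm_pos
  have happ : ApproximatesLinearOn F (e : E →L[ℂ] E) (closedBall p r)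
      ⟨1 / (2 * C), by positivity⟩ := by
    intro x hx y hy
    exact (convex_closedBall p r).norm_image_sub_le_of_norm_fderiv_le' (𝕜 := ℂ)
      (fun w _ => hF w) h hy hx
  have hs := happ.surjOn_closedBall_of_nonlinearRightInverse e.toNonlinearRightInverse hr.le
    (Subset.refl _)
  obtain ⟨p', hp', hpw⟩ := hs (a := w) (by
    rw [mem_closedBall, dist_eq_norm]
    refine hw.trans ?_
    have h1 : r / (2 * C) = (C⁻¹ - 1 / (2 * C)) * r := by field_simp; norm_num
    rw [h1]
    gcongr
    · exact he
    · exact le_rfl)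
  refine ⟨p', hp', hpw, ?_⟩
  have hinj : Function.Injective (fderiv ℂ F p' : E →ₗ[ℂ] E) := by
    rw [← LinearMap.ker_eq_bot, LinearMap.ker_eq_bot']
    intro v hv
    by_contra hv0
    have hv' : 0 < ‖v‖ := norm_pos_iff.2 hv0
    have hv2 : fderiv ℂ F p' v = 0 := hv
    have h1 : ‖(fderiv ℂ F p' - e) v‖ ≤ 1 / (2 * C) * ‖v‖ :=
      ((fderiv ℂ F p' - e).le_opNorm v).trans (by gcongr; exact h p' hp')
    have h2 : ‖v‖ ≤ C * ‖e v‖ := by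
      have := (e.symm : E →L[ℂ] E).le_opNorm (e v)
      simp only [ContinuousLinearEquiv.coe_coe, ContinuousLinearEquiv.symm_apply_apply] at this
      exact this.trans (by gcongr)
    simp only [sub_apply, hv2, zero_sub, norm_neg,
      ContinuousLinearEquiv.coe_coe] at h1
    have h3 : C * ‖e v‖ ≤ C * (1 / (2 * C) * ‖v‖) := by gcongr
    have h4 : C * (1 / (2 * C) * ‖v‖) = ‖v‖ / 2 := by field_simp
    linarith
  exact LinearMap.injective_iff_surjective.1 hinj

/-- The determinant of a linear endomorphism of `ℂ × ℂ`. -/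
def jac (A : ℂ × ℂ →L[ℂ] ℂ × ℂ) : ℂ :=
  (A (1, 0)).1 * (A (0, 1)).2 - (A (1, 0)).2 * (A (0, 1)).1

theorem jac_inverse (A : ℂ × ℂ →L[ℂ] ℂ × ℂ) {M δ : ℝ} (hδ : 0 < δ) (hA : ‖A‖ ≤ M)
    (hj : δ ≤ ‖jac A‖) : ∃ e : (ℂ × ℂ) ≃L[ℂ] ℂ × ℂ, (e : ℂ × ℂ →L[ℂ] ℂ × ℂ) = A ∧
      ‖(e.symm : ℂ × ℂ →L[ℂ] ℂ × ℂ)‖ ≤ 2 * M / δ := by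
  have hM : 0 ≤ M := (norm_nonneg _).trans hA
  have hj0 : jac A ≠ 0 := norm_pos_iff.1 (hδ.trans_le hj)
  have hcol : ∀ v : ℂ × ℂ, ‖v‖ ≤ 1 → ‖(A v).1‖ ≤ M ∧ ‖(A v).2‖ ≤ M := fun v hv => by
    have h := A.le_opNorm v
    have h' : ‖A v‖ ≤ M := h.trans (by nlinarith [norm_nonneg A, norm_nonneg v])
    exact ⟨(norm_fst_le _).trans h', (norm_snd_le _).trans h'⟩
  have h10 := hcol (1, 0) (by simp)
  have h01 := hcol (0, 1) (by simp)
  let a := (A (1, 0)).1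
  let b := (A (0, 1)).1
  let c := (A (1, 0)).2
  let d := (A (0, 1)).2
  have hAv : ∀ v : ℂ × ℂ, A v = (v.1 * a + v.2 * b, v.1 * c + v.2 * d) := fun v => by
    have h1 : v = v.1 • ((1 : ℂ), (0 : ℂ)) + v.2 • ((0 : ℂ), (1 : ℂ)) := by ext <;> simp
    conv_lhs => rw [h1]
    rw [map_add, map_smul, map_smul]
    ext <;> simp [a, b, c, d]
  have hjd : jac A = a * d - c * b := rfl
  let B : ℂ × ℂ →L[ℂ] ℂ × ℂ := (jac A)⁻¹ •
    ((d • ContinuousLinearMap.fst ℂ ℂ ℂ - b • ContinuousLinearMap.snd ℂ ℂ ℂ).prod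
      (a • ContinuousLinearMap.snd ℂ ℂ ℂ - c • ContinuousLinearMap.fst ℂ ℂ ℂ))
  have hBv : ∀ v : ℂ × ℂ, B v = ((jac A)⁻¹ * (d * v.1 - b * v.2),
      (jac A)⁻¹ * (a * v.2 - c * v.1)) := fun v => by ext <;> simp [B]
  have hd0 : a * d - c * b ≠ 0 := hjd ▸ hj0
  refine ⟨ContinuousLinearEquiv.equivOfInverse A B (fun v => ?_) (fun v => ?_), ?_, ?_⟩
  · rw [hBv, hAv, hjd]; ext <;> simp only <;> field_simp <;> ring
  · rw [hAv, hBv, hjd]; ext <;> simp only <;> field_simp <;> ring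
  · ext <;> rfl
  · refine ContinuousLinearMap.opNorm_le_bound _ (by positivity) fun v => ?_
    change ‖B v‖ ≤ _
    have hji : ‖(jac A)⁻¹‖ ≤ δ⁻¹ := by rw [norm_inv]; gcongr
    have hgen : ∀ x y u w : ℂ, ‖x‖ ≤ M → ‖y‖ ≤ M → ‖u‖ ≤ ‖v‖ → ‖w‖ ≤ ‖v‖ →
        ‖(jac A)⁻¹ * (x * u - y * w)‖ ≤ 2 * M / δ * ‖v‖ := by
      intro x y u w hx hy hu hw
      rw [norm_mul]
      have : ‖x * u - y * w‖ ≤ 2 * M * ‖v‖ := by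
        refine (norm_sub_le _ _).trans ?_
        rw [norm_mul, norm_mul]
        have h1 : ‖x‖ * ‖u‖ ≤ M * ‖v‖ := by gcongr
        have h2 : ‖y‖ * ‖w‖ ≤ M * ‖v‖ := by gcongr
        linarith
      calc _ ≤ δ⁻¹ * (2 * M * ‖v‖) := by gcongr
        _ = _ := by ring
    rw [hBv, Prod.norm_def]
    exact max_le (hgen _ _ _ _ h01.2 h01.1 (norm_fst_le v) (norm_snd_le v))
      (hgen _ _ _ _ h10.1 h10.2 (norm_snd_le v) (norm_fst_le v))

theorem exists_value_covered {a a' k : ℝ} (ha : 0 < a) (haa : a < a') (hk : 1 ≤ k) :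
    ∃ ε > 0, ∀ F : ℂ × ℂ → ℂ × ℂ, Differentiable ℂ F → F 0 = 0 → 1 ≤ ‖jac (fderiv ℂ F 0)‖ →
      (∀ z ∈ closedBall (0 : ℂ × ℂ) a', ‖F z‖ ≤ k + 1) →
      (∃ z ∈ closedBall (0 : ℂ × ℂ) a, k < ‖F z‖) →
      ∃ p, k - 1 / 2 ≤ ‖F p‖ ∧ ‖F p‖ ≤ k + 1 ∧ ∀ w, ‖w - F p‖ ≤ ε →
        ∃ p', F p' = w ∧ Function.Surjective (fderiv ℂ F p') := by
  obtain ⟨s, hs, rfl⟩ : ∃ s > 0, a' = a + 4 * s := ⟨(a' - a) / 4, by linarith, by ring⟩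
  have hM : 0 < k + 1 := by linarith
  set D := (k + 1) / s with hD
  have hD0 : 0 < D := by positivity
  set ρ := min s (1 / (2 * D)) with hρ
  have hρ0 : 0 < ρ := by positivity
  obtain ⟨δ, hδ, hδ'⟩ := exists_norm_ge_near (M := 2 * D ^ 2) ha
    (show a < a + 2 * s by linarith) hρ0
  set C := 2 * D / δ with hC
  have hC0 : 0 < C := by positivity
  set r := min s (1 / (2 * C) / (D / s)) with hr
  have hr0 : 0 < r := by positivity
  refine ⟨r / (2 * C), by positivity, fun F hF hF0 hFj hFM ⟨z, hz, hkz⟩ => ?_⟩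
  rw [mem_closedBall_zero_iff] at hz
  have hlip : ∀ x y, ‖x‖ ≤ a + 3 * s → ‖y‖ ≤ a + 3 * s → ‖F y - F x‖ ≤ D * ‖y - x‖ :=
    fun x y hx hy => norm_sub_le_of_closedBall hF hs
      (fun w hw => hFM w (by rwa [show a + 4 * s = a + 3 * s + s by ring]))
      (mem_closedBall_zero_iff.2 hx) (mem_closedBall_zero_iff.2 hy)
  have hder : ∀ x, ‖x‖ ≤ a + 3 * s → ‖fderiv ℂ F x‖ ≤ D := fun x hx =>
    norm_fderiv_le_of_closedBall hF hs fun w hw => hFM w (by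
      rw [mem_closedBall, dist_eq_norm] at *
      have := norm_le_norm_add_norm_sub x w
      rw [norm_sub_rev] at this
      rw [sub_zero]
      rw [norm_sub_rev] at this
      have h2 := norm_le_norm_add_norm_sub x w
      linarith [norm_sub_rev x w])
  have hlip2 : ∀ x y, ‖x‖ ≤ a + 2 * s → ‖y‖ ≤ a + 2 * s →
      ‖fderiv ℂ F y - fderiv ℂ F x‖ ≤ D / s * ‖y - x‖ := fun x y hx hy => by
    have := norm_fderiv_sub_le_of_closedBall hF (z := 0) (r := a + 2 * s) hs
      (fun w hw => hFM w (by rwa [show a + 4 * s = a + 2 * s + s + s by ring]))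
      (mem_closedBall_zero_iff.2 hx) (mem_closedBall_zero_iff.2 hy)
    calc _ ≤ _ := this
      _ = _ := by rw [hD]; ring
  obtain ⟨t, ht, htk⟩ : ∃ t ∈ Icc (0 : ℝ) 1, ‖F (t • z)‖ = k := by
    have hcont : ContinuousOn (fun t : ℝ => ‖F (t • z)‖) (Icc 0 1) :=
      (hF.continuous.comp (by fun_prop)).norm.continuousOn
    refine intermediate_value_Icc zero_le_one hcont ⟨?_, ?_⟩
    · simp [hF0]; linarith
    · simpa using hkz.le
  set q := t • z with hq
  have hqa : ‖q‖ ≤ a := by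
    rw [hq, norm_smul, Real.norm_eq_abs, abs_of_nonneg ht.1]
    nlinarith [ht.2, norm_nonneg z]
  have hq0 : q ≠ 0 := by
    intro h
    rw [h, hF0, norm_zero] at htk
    linarith
  have hqn : 0 < ‖q‖ := norm_pos_iff.2 hq0
  let u : ℂ × ℂ := ((‖q‖ : ℂ))⁻¹ • q
  have hu : ‖u‖ = 1 := by simp [u, norm_smul, hqn.ne']
  have hqu : q = (‖q‖ : ℂ) • u := by
    have : (‖q‖ : ℂ) ≠ 0 := by exact_mod_cast hqn.ne'
    simp only [u]
    rw [smul_inv_smul₀ this]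
  have hjd : Differentiable ℂ fun ζ : ℂ => jac (fderiv ℂ F (ζ • u)) := by
    have hA : ∀ v : ℂ × ℂ, Differentiable ℂ fun ζ : ℂ => fderiv ℂ F (ζ • u) v := fun v =>
      hF.fderiv_apply_complex.comp (g := fun p : (ℂ × ℂ) × ℂ × ℂ => fderiv ℂ F p.1 p.2)
        (f := fun ζ : ℂ => (ζ • u, v)) (by fun_prop)
    have h1 := hA (1, 0)
    have h2 := hA (0, 1)
    unfold jac
    fun_prop
  obtain ⟨ζ, hζ, hζδ⟩ := hδ' _ hjd (fun ζ hζ => by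
      rw [mem_closedBall_zero_iff] at hζ
      have h1 := hder (ζ • u) (by rw [norm_smul, hu]; linarith)
      have hcol : ∀ v : ℂ × ℂ, ‖v‖ ≤ 1 → ‖fderiv ℂ F (ζ • u) v‖ ≤ D := fun v hv =>
        ((fderiv ℂ F (ζ • u)).le_opNorm v).trans (by
          nlinarith [norm_nonneg v, norm_nonneg (fderiv ℂ F (ζ • u))])
      have h10 := hcol (1, 0) (by simp)
      have h01 := hcol (0, 1) (by simp)
      unfold jac
      refine (norm_sub_le _ _).trans ?_
      rw [norm_mul, norm_mul, two_mul, sq]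
      have h3 := (norm_fst_le _).trans h10
      have h4 := (norm_snd_le _).trans h10
      have h5 := (norm_fst_le _).trans h01
      have h6 := (norm_snd_le _).trans h01
      gcongr) (by simpa using hFj) (‖q‖ : ℂ) (by simpa using hqa)
  set p := ζ • u with hp
  have hpq : ‖p - q‖ ≤ ρ := by
    rw [hqu, hp, ← sub_smul, norm_smul, hu, mul_one]; exact hζ
  have hpa : ‖p‖ ≤ a + s := by
    have := norm_le_norm_add_norm_sub' p q
    linarith [min_le_left s (1 / (2 * D))]
  have hFp : ‖F p - F q‖ ≤ 1 / 2 := by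
    refine (hlip q p (by linarith) (by linarith)).trans ?_
    calc D * ‖p - q‖ ≤ D * (1 / (2 * D)) := by gcongr; exact hpq.trans (min_le_right _ _)
      _ = 1 / 2 := by field_simp
  have h1 := norm_le_norm_add_norm_sub' (F p) (F q)
  have h2 := norm_le_norm_add_norm_sub (F p) (F q)
  refine ⟨p, by linarith, by linarith, fun w hw => ?_⟩
  obtain ⟨e, he, he'⟩ := jac_inverse (fderiv ℂ F p) hδ (hder p (by linarith)) hζδ
  obtain ⟨p', -, h3, h4⟩ := exists_eq_of_fderiv_near hF hr0 hC0 e he' (fun x hx => by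
    rw [he]
    rw [mem_closedBall, dist_eq_norm] at hx
    have h5 := norm_le_norm_add_norm_sub' x p
    have h6 : r ≤ s := min_le_left _ _
    refine (hlip2 p x (by linarith) (by linarith)).trans ?_
    calc D / s * ‖x - p‖ ≤ D / s * (1 / (2 * C) / (D / s)) := by
          gcongr; exact hx.trans (min_le_right _ _)
      _ = _ := by field_simp) hw
  exact ⟨p', h3, h4⟩

theorem exists_unavoidable_sequence : ∃ (e : ℕ → ℂ × ℂ) (δ : ℕ → ℝ), (∀ j, e j ≠ 0) ∧
    (∀ j, 0 < δ j) ∧ Tendsto (fun j => ‖e j‖) atTop atTop ∧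
    ∀ F : ℂ × ℂ → ℂ × ℂ, Differentiable ℂ F → F 0 = 0 →
      fderiv ℂ F 0 = ContinuousLinearMap.id ℂ (ℂ × ℂ) → ∀ e' : ℕ → ℂ × ℂ,
      (∀ j, ‖e' j - e j‖ ≤ δ j) → ∃ j p, F p = e' j ∧ Function.Surjective (fderiv ℂ F p) := by
  obtain ⟨a, ha, ha2, haa⟩ : ∃ a : ℕ → ℝ, (∀ k, 3 / 2 ≤ a k) ∧ (∀ k, a k ≤ 2) ∧
      ∀ k, a k < a (k + 1) := by
    refine ⟨fun k => 2 - 1 / ((k : ℝ) + 2), fun k => ?_, fun k => ?_, fun k => ?_⟩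
    · have : 1 / ((k : ℝ) + 2) ≤ 1 / 2 := by gcongr; linarith [(Nat.cast_nonneg k : (0 : ℝ) ≤ k)]
      linarith
    · have : 0 < 1 / ((k : ℝ) + 2) := by positivity
      linarith
    · have : 1 / (((k + 1 : ℕ) : ℝ) + 2) < 1 / ((k : ℝ) + 2) := by gcongr; simp
      linarith
  have hQ : ∀ k : ℕ, _ := fun k => exists_value_covered (a := a k) (a' := a (k + 1))
    (k := (k : ℝ) + 1) (by linarith [ha k]) (haa k)
    (by linarith [(Nat.cast_nonneg k : (0 : ℝ) ≤ k)])
  choose ε hε hQ using hQ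
  have hnet : ∀ k : ℕ, ∃ t ⊆ closedBall (0 : ℂ × ℂ) (k + 1 + 1) ∩ {z | (k : ℝ) + 1 - 1 / 2 ≤ ‖z‖},
      t.Finite ∧ closedBall (0 : ℂ × ℂ) (k + 1 + 1) ∩ {z | (k : ℝ) + 1 - 1 / 2 ≤ ‖z‖} ⊆
        ⋃ x ∈ t, ball x (ε k / 2) := fun k =>
    ((isCompact_closedBall _ _).inter_right
      (isClosed_le continuous_const continuous_norm)).finite_cover_balls (by linarith [hε k])
  choose t ht htf htc using hnet
  have htne : ∀ k, (t k).Nonempty := fun k => by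
    have hmem : (((k : ℂ) + 1), (0 : ℂ)) ∈
        closedBall (0 : ℂ × ℂ) (k + 1 + 1) ∩ {z | (k : ℝ) + 1 - 1 / 2 ≤ ‖z‖} := by
      have h1 : ‖((k : ℂ) + 1)‖ = (k : ℝ) + 1 := by exact_mod_cast Complex.norm_natCast (k + 1)
      have h2 : ‖(((k : ℂ) + 1), (0 : ℂ))‖ = (k : ℝ) + 1 := by
        rw [Prod.norm_def, h1]; simp; positivity
      simp only [mem_inter_iff, mem_closedBall_zero_iff, mem_ofPred_eq, h2]
      constructor <;> linarith
    have := htc k hmem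
    simp only [mem_iUnion] at this
    obtain ⟨x, hx, -⟩ := this
    exact ⟨x, hx⟩
  have : ∀ k, Finite (t k) := fun k => (htf k).to_subtype
  let I := Σ k : ℕ, t k
  have : Infinite I := Infinite.of_injective (fun k : ℕ => (⟨k, ⟨_, (htne k).some_mem⟩⟩ : I))
    fun x y h => by simpa using congrArg Sigma.fst h
  obtain ⟨hden⟩ := nonempty_denumerable I
  let g : ℕ ≃ I := (Denumerable.eqv I).symm
  have hlow : ∀ i : I, (i.1 : ℝ) + 1 - 1 / 2 ≤ ‖(i.2 : ℂ × ℂ)‖ := fun i => (ht i.1 i.2.2).2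
  refine ⟨fun j => (g j).2, fun j => ε (g j).1 / 2, fun j => ?_, fun j => by linarith [hε (g j).1],
    ?_, ?_⟩
  · rw [← norm_pos_iff]
    have := hlow (g j)
    linarith [(Nat.cast_nonneg (g j).1 : (0 : ℝ) ≤ _)]
  · have h1 : Tendsto (fun i : I => i.1) cofinite atTop := by
      rw [Filter.tendsto_atTop]
      intro b
      rw [eventually_cofinite]
      have h2 : {i : I | ¬ b ≤ i.1} ⊆ ⋃ k ∈ Iio b, range fun x : t k => (⟨k, x⟩ : I) := by
        rintro ⟨k, x⟩ hk
        simp only [mem_ofPred_eq, not_le] at hk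
        simp only [mem_iUnion]
        exact ⟨k, hk, x, rfl⟩
      exact ((finite_Iio b).biUnion fun k _ => finite_range _).subset h2
    have h3 : Tendsto (fun j => (g j).1) atTop atTop := by
      rw [← Nat.cofinite_eq_atTop]
      exact (Nat.cofinite_eq_atTop ▸ h1).comp g.injective.tendsto_cofinite
    refine tendsto_atTop_mono (fun j => ?_) (tendsto_natCast_atTop_atTop.comp h3)
    have := hlow (g j)
    simp only [Function.comp]
    linarith
  · intro F hF hF0 hF1 e' he'
    by_contra! hcon
    have hj1 : 1 ≤ ‖jac (fderiv ℂ F 0)‖ := by simp [jac, hF1]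
    have hstep : ∀ k : ℕ, (∀ z ∈ closedBall (0 : ℂ × ℂ) (a (k + 1)), ‖F z‖ ≤ (k : ℝ) + 1 + 1) →
        ∀ z ∈ closedBall (0 : ℂ × ℂ) (a k), ‖F z‖ ≤ (k : ℝ) + 1 := by
      intro k hk
      by_contra! hcon2
      obtain ⟨p, hp1, hp2, hp3⟩ := hQ k F hF hF0 hj1 hk hcon2
      have := htc k (show F p ∈ _ from ⟨by simpa using hp2, hp1⟩)
      simp only [mem_iUnion] at this
      obtain ⟨x, hx, hxp⟩ := this
      let i : I := ⟨k, ⟨x, hx⟩⟩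
      have h1 : ‖e' (g.symm i) - (g (g.symm i)).2‖ ≤ ε (g (g.symm i)).1 / 2 := he' (g.symm i)
      rw [g.apply_symm_apply] at h1
      obtain ⟨p', hp', hp''⟩ := hp3 (e' (g.symm i)) (by
        rw [mem_ball, dist_eq_norm, norm_sub_rev] at hxp
        calc ‖e' (g.symm i) - F p‖ ≤ ‖e' (g.symm i) - x‖ + ‖x - F p‖ := 
              norm_sub_le_norm_sub_add_norm_sub _ _ _
          _ ≤ ε k / 2 + ε k / 2 := by gcongr
          _ = ε k := by ring)
      exact hcon _ _ hp' hp''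
    obtain ⟨M, -, hM⟩ := exists_norm_le_of_continuous hF.continuous 2
    obtain ⟨K, hK⟩ := exists_nat_ge M
    have hall : ∀ d k : ℕ, k + d = K → ∀ z ∈ closedBall (0 : ℂ × ℂ) (a k), ‖F z‖ ≤ (k : ℝ) + 1 := by
      intro d
      induction d with
      | zero =>
        rintro k rfl z hz
        have := hM z (closedBall_subset_closedBall (ha2 _) hz)
        simp at hK
        linarith
      | succ d ih =>
        intro k hk
        refine hstep k ?_
        have := ih (k + 1) (by omega)
        simpa using this
    have h0 := hall K 0 (by simp)
    have h1 := norm_fderiv_le_of_closedBall hF (z := 0) (s := a 0) (by linarith [ha 0]) h0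
    rw [hF1, ContinuousLinearMap.norm_id] at h1
    rw [le_div_iff₀ (by linarith [ha 0])] at h1
    have := ha 0
    simp at h1
    linarith

theorem clm_apply_eq (l : ℂ × ℂ →L[ℂ] ℂ) (z : ℂ × ℂ) :
    l z = l (1, 0) * z.1 + l (0, 1) * z.2 := by
  have h : z = z.1 • ((1 : ℂ), (0 : ℂ)) + z.2 • ((0 : ℂ), (1 : ℂ)) := by
    ext <;> simp
  rw [h, map_add, map_smul, map_smul]
  simp [mul_comm]

/-- The exponential of a linear form, as a continuous function. -/
def expMap (l : ℂ × ℂ →L[ℂ] ℂ) : C(ℂ × ℂ, ℂ) := ⟨fun z => Complex.exp (l z), by fun_prop⟩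

@[simp] theorem expMap_apply (l : ℂ × ℂ →L[ℂ] ℂ) (z : ℂ × ℂ) : expMap l z = Complex.exp (l z) := rfl

/-- The algebra of exponential polynomials. -/
def expAlg : Subalgebra ℂ C(ℂ × ℂ, ℂ) := Algebra.adjoin ℂ (range expMap)

theorem expAlg_induction {p : C(ℂ × ℂ, ℂ) → Prop} (h0 : p 0)
    (hadd : ∀ g h, p g → p h → p (g + h))
    (hexp : ∀ (a : ℂ) l, p (a • expMap l)) {g : C(ℂ × ℂ, ℂ)} (hg : g ∈ expAlg) : p g := by
  let M : Submonoid C(ℂ × ℂ, ℂ) :=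
    { carrier := range expMap
      one_mem' := ⟨0, by ext z; simp⟩
      mul_mem' := by
        rintro _ _ ⟨l, rfl⟩ ⟨l', rfl⟩
        exact ⟨l + l', by ext z; simp [Complex.exp_add]⟩ }
  have hM : (Submonoid.closure (range expMap) : Set C(ℂ × ℂ, ℂ)) = range expMap := by
    have := Submonoid.closure_eq M
    exact congrArg _ this
  have hg' : g ∈ Submodule.span ℂ (range expMap) := by
    have : g ∈ Subalgebra.toSubmodule expAlg := hg
    rwa [expAlg, Algebra.adjoin_eq_span, hM] at this
  rw [Finsupp.mem_span_range_iff_exists_finsupp] at hg'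
  obtain ⟨c, rfl⟩ := hg'
  exact Finset.sum_induction _ p (fun a b => hadd a b) h0 fun l _ => hexp _ _

/-- Functions which are locally uniform limits of exponential polynomials. -/
def InA (h : ℂ × ℂ → ℂ) : Prop := ∃ g ∈ expAlg.topologicalClosure, ∀ z, g z = h z

theorem InA.continuous {h : ℂ × ℂ → ℂ} (hh : InA h) : Continuous h := by
  obtain ⟨g, -, hg⟩ := hh
  rw [← funext hg]
  exact g.continuous

theorem inA_iff {h : ℂ × ℂ → ℂ} (hc : Continuous h) : InA h ↔
    (⟨h, hc⟩ : C(ℂ × ℂ, ℂ)) ∈ expAlg.topologicalClosure := by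
  constructor
  · rintro ⟨g, hg, hgh⟩
    convert hg
    ext z
    exact (hgh z).symm
  · exact fun h => ⟨_, h, fun _ => rfl⟩

theorem InA.add {g h : ℂ × ℂ → ℂ} (hg : InA g) (hh : InA h) : InA (fun z => g z + h z) := by
  obtain ⟨g', hg', hg⟩ := hg
  obtain ⟨h', hh', hh⟩ := hh
  exact ⟨g' + h', add_mem hg' hh', fun z => by simp [hg, hh]⟩

theorem InA.mul {g h : ℂ × ℂ → ℂ} (hg : InA g) (hh : InA h) : InA (fun z => g z * h z) := by
  obtain ⟨g', hg', hg⟩ := hg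
  obtain ⟨h', hh', hh⟩ := hh
  exact ⟨g' * h', mul_mem hg' hh', fun z => by simp [hg, hh]⟩

theorem inA_const (c : ℂ) : InA (fun _ => c) :=
  ⟨algebraMap ℂ _ c, Subalgebra.algebraMap_mem _ c, fun z => by simp⟩

theorem InA.pow {g : ℂ × ℂ → ℂ} (hg : InA g) (N : ℕ) : InA (fun z => g z ^ N) := by
  obtain ⟨g', hg', hg⟩ := hg
  exact ⟨g' ^ N, pow_mem hg' N, fun z => by simp [hg]⟩

theorem inA_expMap (l : ℂ × ℂ →L[ℂ] ℂ) : InA (fun z => Complex.exp (l z)) :=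
  ⟨expMap l, Subalgebra.le_topologicalClosure _ (Algebra.subset_adjoin ⟨l, rfl⟩), fun _ => rfl⟩

theorem InA.exists_approx {h : ℂ × ℂ → ℂ} (hh : InA h) {K : Set (ℂ × ℂ)} (hK : IsCompact K)
    {ε : ℝ} (hε : 0 < ε) : ∃ g ∈ expAlg, ∀ z ∈ K, ‖g z - h z‖ < ε := by
  obtain ⟨g, hg, hgh⟩ := hh
  have hg' : g ∈ closure (expAlg : Set C(ℂ × ℂ, ℂ)) := hg
  rw [mem_closure_iff_frequently] at hg'
  have h1 : ∀ᶠ f : C(ℂ × ℂ, ℂ) in 𝓝 g, ∀ z ∈ K, ‖f z - h z‖ < ε := by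
    have := ContinuousMap.tendsto_iff_forall_isCompact_tendstoUniformlyOn.1
      (tendsto_id (x := 𝓝 g)) K hK
    have := Metric.tendstoUniformlyOn_iff.1 this ε hε
    filter_upwards [this] with f hf z hz
    have := hf z hz
    rwa [dist_comm, dist_eq_norm, hgh] at this
  obtain ⟨f, hf, hfg⟩ := (hg'.and_eventually h1).exists
  exact ⟨f, hf, hfg⟩

theorem inA_of_tendsto {h : ℂ × ℂ → ℂ} (hc : Continuous h) {H : ℕ → ℂ × ℂ → ℂ}
    (hH : ∀ n, InA (H n)) (hlim : ∀ K, IsCompact K → TendstoUniformlyOn H h atTop K) : InA h := by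
  rw [inA_iff hc]
  have : Tendsto (fun n => (⟨H n, (hH n).continuous⟩ : C(ℂ × ℂ, ℂ))) atTop (𝓝 ⟨h, hc⟩) :=
    ContinuousMap.tendsto_iff_forall_isCompact_tendstoUniformlyOn.2 hlim
  exact expAlg.isClosed_topologicalClosure.mem_of_tendsto this
    (Eventually.of_forall fun n => (inA_iff _).1 (hH n))

theorem InA.differentiable {h : ℂ × ℂ → ℂ} (hh : InA h) : Differentiable ℂ h := by
  have : ∀ n : ℕ, ∃ g : ℂ × ℂ → ℂ, Differentiable ℂ g ∧
      ∀ z ∈ closedBall (0 : ℂ × ℂ) n, ‖g z - h z‖ < 1 / (n + 1 : ℝ) := by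
    intro n
    obtain ⟨g, hg, hgh⟩ := hh.exists_approx (isCompact_closedBall (0 : ℂ × ℂ) n)
      (show (0 : ℝ) < 1 / (n + 1 : ℝ) by positivity)
    refine ⟨g, ?_, hgh⟩
    refine expAlg_induction (p := fun g : C(ℂ × ℂ, ℂ) => Differentiable ℂ g) ?_ ?_ ?_ hg
    · exact differentiable_const 0
    · intro g h hg hh
      exact hg.add hh
    · intro a l
      have : Differentiable ℂ fun z => a • Complex.exp (l z) := by fun_prop
      exact this
  choose g hg hgh using this
  refine (differentiable_of_tendstoUniformlyOn_closedBall hg fun R => ?_).1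
  rw [Metric.tendstoUniformlyOn_iff]
  intro ε hε
  obtain ⟨n₀, hn₀⟩ := exists_nat_gt R
  obtain ⟨n₁, hn₁⟩ := exists_nat_one_div_lt hε
  filter_upwards [eventually_ge_atTop (max n₀ n₁)] with n hn z hz
  rw [dist_comm, dist_eq_norm]
  have h0 : (n₀ : ℝ) ≤ n := by exact_mod_cast (le_max_left _ _).trans hn
  have h1 : (n₁ : ℝ) ≤ n := by exact_mod_cast (le_max_right _ _).trans hn
  refine (hgh n z ?_).trans (lt_of_le_of_lt ?_ hn₁)
  · exact closedBall_subset_closedBall (by linarith) hz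
  · gcongr

theorem tendstoUniformlyOn_of_norm_sub_le {H : ℕ → ℂ × ℂ → ℂ} {h : ℂ × ℂ → ℂ} {K : Set (ℂ × ℂ)}
    {b : ℕ → ℝ} (hb : Tendsto b atTop (𝓝 0)) (hle : ∀ᶠ n in atTop, ∀ z ∈ K, ‖H n z - h z‖ ≤ b n) :
    TendstoUniformlyOn H h atTop K := by
  rw [Metric.tendstoUniformlyOn_iff]
  intro ε hε
  filter_upwards [hle, hb.eventually_lt_const hε] with n hn hn' z hz
  rw [dist_comm, dist_eq_norm]
  exact (hn z hz).trans_lt hn'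

theorem inA_linear (l : ℂ × ℂ →L[ℂ] ℂ) : InA l := by
  refine inA_of_tendsto l.continuous
    (H := fun n z => (n : ℂ) * (Complex.exp (((n : ℂ)⁻¹ • l) z) + (-1))) ?_ ?_
  · intro n
    exact (inA_const _).mul ((inA_expMap _).add (inA_const _))
  · intro K hK
    obtain ⟨C, hC⟩ := hK.exists_bound_of_continuousOn l.continuous.continuousOn
    refine tendstoUniformlyOn_of_norm_sub_le (b := fun n : ℕ => C ^ 2 / n)
      (tendsto_const_div_atTop_nhds_zero_nat _) ?_
    filter_upwards [eventually_ge_atTop (⌈C⌉₊ + 1)] with n hn z hz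
    have hn0 : 0 < n := by omega
    have hn1 : (0 : ℝ) < n := by exact_mod_cast hn0
    have hCn : C ≤ n := (Nat.le_ceil C).trans (by exact_mod_cast (Nat.le_succ _).trans hn)
    have h1 : ‖(n : ℂ)⁻¹ * l z‖ ≤ C / n := by
      rw [norm_mul, norm_inv, Complex.norm_natCast, inv_mul_eq_div]
      gcongr
      exact hC z hz
    have h2 : ‖(n : ℂ)⁻¹ * l z‖ ≤ 1 := h1.trans ((div_le_one hn1).2 hCn)
    have h3 := Complex.norm_exp_sub_one_sub_id_le h2
    have h4 : (n : ℂ) * (Complex.exp (((n : ℂ)⁻¹ • l) z) + (-1)) - l z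
        = n * (Complex.exp ((n : ℂ)⁻¹ * l z) - 1 - (n : ℂ)⁻¹ * l z) := by
      have : (n : ℂ) ≠ 0 := by exact_mod_cast hn0.ne'
      simp only [smul_apply, smul_eq_mul]
      field_simp
      ring
    rw [h4, norm_mul, Complex.norm_natCast]
    calc (n : ℝ) * _ ≤ n * (C / n) ^ 2 := by gcongr; exact h3.trans (by gcongr)
      _ = C ^ 2 / n := by field_simp

theorem InA.cexp {g : ℂ × ℂ → ℂ} (hg : InA g) : InA (fun z => Complex.exp (g z)) := by
  refine inA_of_tendsto (by have := hg.continuous; fun_prop)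
    (H := fun n z => ∑ k ∈ Finset.range n, g z ^ k / (k.factorial : ℂ)) ?_ ?_
  · intro n
    induction n with
    | zero => simpa using inA_const 0
    | succ n ih =>
      simp only [Finset.sum_range_succ]
      refine ih.add ?_
      simpa [div_eq_mul_inv] using (hg.pow n).mul (inA_const _)
  · intro K hK
    obtain ⟨C, hC⟩ := hK.exists_bound_of_continuousOn hg.continuous.continuousOn
    have hs : HasSum (fun k : ℕ => |C| ^ k / (k.factorial : ℝ)) (Real.exp |C|) := by
      simpa [Real.exp_eq_exp_ℝ] using NormedSpace.expSeries_div_hasSum_exp (𝔸 := ℝ) |C|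
    have hle := hs.tendsto_sum_nat
    refine tendstoUniformlyOn_of_norm_sub_le
      (b := fun n : ℕ => Real.exp |C| - ∑ k ∈ Finset.range n, |C| ^ k / (k.factorial : ℝ)) ?_ ?_
    · simpa using (tendsto_const_nhds (x := Real.exp |C|)).sub hle
    · refine Eventually.of_forall fun n z hz => ?_
      rw [norm_sub_rev]
      have hC' : ‖g z‖ ≤ |C| := (hC z hz).trans (le_abs_self C)
      have h1 : HasSum (fun k : ℕ => g z ^ k / (k.factorial : ℂ)) (Complex.exp (g z)) := by
        simpa [Complex.exp_eq_exp_ℂ] using NormedSpace.expSeries_div_hasSum_exp (𝔸 := ℂ) (g z)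
      have h2 := (hasSum_nat_add_iff' n).2 h1
      have h3 := (hasSum_nat_add_iff' n).2 hs
      rw [← h2.tsum_eq, ← h3.tsum_eq]
      refine tsum_of_norm_bounded h3.summable.hasSum fun k => ?_
      rw [norm_div, norm_pow, Complex.norm_natCast]
      gcongr

/-- A self-map of `ℂ × ℂ` both of whose components lie in the closure of the exponential
polynomials. -/
def InA₂ (τ : ℂ × ℂ → ℂ × ℂ) : Prop := InA (fun z => (τ z).1) ∧ InA (fun z => (τ z).2)

theorem InA₂.differentiable {τ : ℂ × ℂ → ℂ × ℂ} (h : InA₂ τ) : Differentiable ℂ τ :=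
  h.1.differentiable.prodMk h.2.differentiable

theorem InA.comp {h : ℂ × ℂ → ℂ} {τ : ℂ × ℂ → ℂ × ℂ} (hh : InA h) (hτ : InA₂ τ) :
    InA (fun z => h (τ z)) := by
  obtain ⟨g, hg, hgh⟩ := hh
  have hτc := hτ.differentiable.continuous
  let T : C(ℂ × ℂ, ℂ × ℂ) := ⟨τ, hτc⟩
  let Φ : C(ℂ × ℂ, ℂ) →ₐ[ℂ] C(ℂ × ℂ, ℂ) := ContinuousMap.compRightAlgHom ℂ ℂ T
  have hΦ : Continuous Φ := ContinuousMap.continuous_precomp T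
  have key : expAlg.topologicalClosure ≤ expAlg.topologicalClosure.comap Φ := by
    refine Subalgebra.topologicalClosure_minimal ?_ ?_
    · refine Algebra.adjoin_le ?_
      rintro _ ⟨l, rfl⟩
      have h1 : InA (fun z => Complex.exp (l (1, 0) * (τ z).1 + l (0, 1) * (τ z).2)) :=
        (((inA_const _).mul hτ.1).add ((inA_const _).mul hτ.2)).cexp
      obtain ⟨u, hu, hu'⟩ := h1
      change Φ (expMap l) ∈ expAlg.topologicalClosure
      convert hu using 1
      ext z
      rw [hu']
      change Complex.exp (l (τ z)) = _
      congr 1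
      exact clm_apply_eq l (τ z)
    · exact expAlg.isClosed_topologicalClosure.preimage hΦ
  exact ⟨Φ g, key hg, fun z => hgh (τ z)⟩

theorem InA₂.comp {σ τ : ℂ × ℂ → ℂ × ℂ} (hσ : InA₂ σ) (hτ : InA₂ τ) : InA₂ (fun z => σ (τ z)) :=
  ⟨hσ.1.comp hτ, hσ.2.comp hτ⟩

/-- `τ` is an automorphism with inverse `σ`, both given by limits of exponential polynomials. -/
structure IsAut (τ σ : ℂ × ℂ → ℂ × ℂ) : Prop where
  left : InA₂ τ
  right : InA₂ σ
  left_inv : ∀ z, σ (τ z) = z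
  right_inv : ∀ z, τ (σ z) = z

theorem IsAut.symm {τ σ : ℂ × ℂ → ℂ × ℂ} (h : IsAut τ σ) : IsAut σ τ :=
  ⟨h.right, h.left, h.right_inv, h.left_inv⟩

theorem IsAut.comp {τ σ τ' σ' : ℂ × ℂ → ℂ × ℂ} (h : IsAut τ σ) (h' : IsAut τ' σ') :
    IsAut (fun z => τ (τ' z)) (fun z => σ' (σ z)) :=
  ⟨h.left.comp h'.left, h'.right.comp h.right, fun z => by rw [h.left_inv, h'.left_inv],
    fun z => by rw [h'.right_inv, h.right_inv]⟩

theorem inA_fst : InA (fun z => z.1) := inA_linear (ContinuousLinearMap.fst ℂ ℂ ℂ)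
theorem inA_snd : InA (fun z => z.2) := inA_linear (ContinuousLinearMap.snd ℂ ℂ ℂ)

theorem inA₂_add_const (v : ℂ × ℂ) : InA₂ (fun z => z + v) :=
  ⟨inA_fst.add (inA_const v.1), inA_snd.add (inA_const v.2)⟩

theorem isAut_id : IsAut (fun z => z) (fun z => z) :=
  ⟨⟨inA_fst, inA_snd⟩, ⟨inA_fst, inA_snd⟩, fun _ => rfl, fun _ => rfl⟩

theorem isAut_add_const (v : ℂ × ℂ) : IsAut (fun z => z + v) (fun z => z + (-v)) :=
  ⟨inA₂_add_const v, inA₂_add_const (-v), fun z => by simp, fun z => by simp⟩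

/-- The symplectic gradient of a linear form. -/
def sgrad (l : ℂ × ℂ →L[ℂ] ℂ) : ℂ × ℂ := (l (0, 1), -l (1, 0))

theorem apply_sgrad (l : ℂ × ℂ →L[ℂ] ℂ) : l (sgrad l) = 0 := by
  rw [clm_apply_eq, sgrad]
  ring

theorem isAut_shear (l : ℂ × ℂ →L[ℂ] ℂ) (c : ℂ) :
    IsAut (fun z => z + (c * Complex.exp (l z)) • sgrad l)
      (fun z => z + (-c * Complex.exp (l z)) • sgrad l) := by
  have h : ∀ c : ℂ, InA₂ (fun z => z + (c * Complex.exp (l z)) • sgrad l) := fun c =>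
    ⟨inA_fst.add (((inA_const c).mul (inA_expMap l)).mul (inA_const (sgrad l).1)),
      inA_snd.add (((inA_const c).mul (inA_expMap l)).mul (inA_const (sgrad l).2))⟩
  refine ⟨h c, h (-c), fun z => ?_, fun z => ?_⟩ <;>
  · simp only [map_add, map_smul, apply_sgrad, smul_zero, add_zero]
    rw [add_assoc, ← add_smul]
    simp

/-- `D` is the infinitesimal generator of an entire family of automorphisms through the
identity. -/
def Fam (D : ℂ × ℂ → (ℂ × ℂ →L[ℂ] ℂ × ℂ)) : Prop :=
  ∃ Θ Θ' : (ℂ × ℂ) × (ℂ × ℂ) → ℂ × ℂ, Differentiable ℂ Θ ∧ Differentiable ℂ Θ' ∧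
    (∀ w, IsAut (fun z => Θ (w, z)) (fun z => Θ' (w, z))) ∧
    (∀ z, Θ (0, z) = z) ∧ (∀ z, Θ' (0, z) = z) ∧
    (∀ z, HasFDerivAt (fun w => Θ (w, z)) (D z) 0) ∧
    (∀ z, HasFDerivAt (fun w => Θ' (w, z)) (-D z) 0)

theorem hasFDerivAt_comp_family {Θ : (ℂ × ℂ) × (ℂ × ℂ) → ℂ × ℂ} (hΘ : Differentiable ℂ Θ)
    (h0 : ∀ z, Θ (0, z) = z) {z : ℂ × ℂ} {D D' : ℂ × ℂ →L[ℂ] ℂ × ℂ}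
    (hD : HasFDerivAt (fun w => Θ (w, z)) D 0) {g : ℂ × ℂ → ℂ × ℂ} (hg0 : g 0 = z)
    (hg : HasFDerivAt g D' 0) : HasFDerivAt (fun w => Θ (w, g w)) (D + D') 0 := by
  have hF := (hΘ (0, z)).hasFDerivAt
  set F := fderiv ℂ Θ (0, z)
  have h1 : HasFDerivAt (fun w : ℂ × ℂ => Θ (w, z))
      (F.comp ((ContinuousLinearMap.id ℂ (ℂ × ℂ)).prod 0)) 0 :=
    hF.comp (0 : ℂ × ℂ) ((hasFDerivAt_id (0 : ℂ × ℂ)).prodMk (hasFDerivAt_const z (0 : ℂ × ℂ)))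
  have h2 : HasFDerivAt (fun ζ : ℂ × ℂ => Θ (0, ζ))
      (F.comp ((0 : ℂ × ℂ →L[ℂ] ℂ × ℂ).prod (ContinuousLinearMap.id ℂ (ℂ × ℂ)))) z :=
    hF.comp z ((hasFDerivAt_const (0 : ℂ × ℂ) z).prodMk (hasFDerivAt_id z))
  have h3 : HasFDerivAt (fun ζ : ℂ × ℂ => Θ (0, ζ)) (ContinuousLinearMap.id ℂ (ℂ × ℂ)) z := by
    simp only [h0]
    exact hasFDerivAt_id z
  have hF' : HasFDerivAt Θ F ((0 : ℂ × ℂ), g 0) := by rw [hg0]; exact hF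
  have h4 : HasFDerivAt (fun w => Θ (w, g w))
      (F.comp ((ContinuousLinearMap.id ℂ (ℂ × ℂ)).prod D')) 0 :=
    hF'.comp (0 : ℂ × ℂ) ((hasFDerivAt_id (0 : ℂ × ℂ)).prodMk hg)
  convert h4 using 1
  have e1 := hD.unique h1
  have e2 := h3.unique h2
  refine ContinuousLinearMap.ext fun w => ?_
  have e3 : D' w = F (0, D' w) := congrArg (fun L => L (D' w)) e2
  have e4 : F (w, D' w) = F (w, 0) + F (0, D' w) := by rw [← map_add]; simp
  have e5 : D w = F (w, 0) := by rw [e1]; rfl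
  change D w + D' w = F (w, D' w)
  rw [e4, ← e3, e5]

theorem Fam.add {D D' : ℂ × ℂ → (ℂ × ℂ →L[ℂ] ℂ × ℂ)} (h : Fam D) (h' : Fam D') :
    Fam (fun z => D z + D' z) := by
  obtain ⟨Θ, Λ, hΘ, hΛ, ha, h0, h0', hd, hd'⟩ := h
  obtain ⟨Θ₁, Λ₁, hΘ₁, hΛ₁, ha₁, h0₁, h0₁', hd₁, hd₁'⟩ := h'
  refine ⟨fun p => Θ (p.1, Θ₁ p), fun p => Λ₁ (p.1, Λ p), ?_, ?_, ?_, ?_, ?_, ?_, ?_⟩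
  · exact hΘ.comp (differentiable_fst.prodMk hΘ₁)
  · exact hΛ₁.comp (differentiable_fst.prodMk hΛ)
  · exact fun w => (ha w).comp (ha₁ w)
  · intro z; simp [h0, h0₁]
  · intro z; simp [h0', h0₁']
  · exact fun z => hasFDerivAt_comp_family hΘ h0 (hd z) (h0₁ z) (hd₁ z)
  · intro z
    rw [neg_add_rev]
    exact hasFDerivAt_comp_family hΛ₁ h0₁' (hd₁' z) (h0' z) (hd' z)

theorem fam_zero : Fam (fun _ => 0) := by
  have h : ∀ z : ℂ × ℂ, HasFDerivAt (fun _ : ℂ × ℂ => z) (0 : ℂ × ℂ →L[ℂ] ℂ × ℂ) 0 :=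
    fun z => hasFDerivAt_const z _
  refine ⟨fun p => p.2, fun p => p.2, differentiable_snd, differentiable_snd, fun _ => isAut_id,
    fun _ => rfl, fun _ => rfl, h, fun z => ?_⟩
  rw [neg_zero]
  exact h z

theorem fam_shear (ℓ l : ℂ × ℂ →L[ℂ] ℂ) (a : ℂ) :
    Fam (fun z => ℓ.smulRight ((a * Complex.exp (l z)) • sgrad l)) := by
  have hd : ∀ a : ℂ, Differentiable ℂ fun p : (ℂ × ℂ) × (ℂ × ℂ) =>
      p.2 + (ℓ p.1 * a * Complex.exp (l p.2)) • sgrad l := fun a =>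
    differentiable_snd.add ((((ℓ.differentiable.comp differentiable_fst).mul_const a).mul
      (l.differentiable.comp differentiable_snd).cexp).smul_const _)
  have ha : ∀ w, IsAut (fun z => z + (ℓ w * a * Complex.exp (l z)) • sgrad l)
      (fun z => z + (ℓ w * -a * Complex.exp (l z)) • sgrad l) := by
    intro w
    have := isAut_shear l (ℓ w * a)
    rwa [← mul_neg] at this
  have h0 : ∀ (a : ℂ) (z : ℂ × ℂ), z + (ℓ 0 * a * Complex.exp (l z)) • sgrad l = z := by
    intro a z
    rw [map_zero, zero_mul, zero_mul, zero_smul, add_zero]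
  have hf : ∀ (a : ℂ) (z : ℂ × ℂ), HasFDerivAt
      (fun w => z + (ℓ w * a * Complex.exp (l z)) • sgrad l)
      (ℓ.smulRight ((a * Complex.exp (l z)) • sgrad l)) 0 := by
    intro a z
    have h := (ContinuousLinearMap.hasFDerivAt
      (ℓ.smulRight ((a * Complex.exp (l z)) • sgrad l)) (x := 0)).const_add z
    simpa only [ContinuousLinearMap.smulRight_apply, smul_smul, mul_assoc] using h
  have hn : ∀ z, ℓ.smulRight ((-a * Complex.exp (l z)) • sgrad l)
      = -ℓ.smulRight ((a * Complex.exp (l z)) • sgrad l) := by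
    intro z
    refine ContinuousLinearMap.ext fun w => ?_
    rw [neg_apply, ContinuousLinearMap.smulRight_apply, ContinuousLinearMap.smulRight_apply,
      neg_mul, neg_smul, smul_neg]
  exact ⟨_, _, hd a, hd (-a), ha, h0 a, h0 (-a), hf a, fun z => hn z ▸ hf (-a) z⟩

theorem sgrad_add (l l' : ℂ × ℂ →L[ℂ] ℂ) : sgrad (l + l') = sgrad l + sgrad l' := by
  ext <;> simp [sgrad]; ring

theorem sgrad_smul (a : ℂ) (l : ℂ × ℂ →L[ℂ] ℂ) : sgrad (a • l) = a • sgrad l := by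
  ext <;> simp [sgrad]

theorem norm_sgrad_le (l : ℂ × ℂ →L[ℂ] ℂ) : ‖sgrad l‖ ≤ ‖l‖ := by
  rw [sgrad, Prod.norm_mk, norm_neg]
  refine max_le ?_ ?_
  · simpa using l.le_opNorm (0, 1)
  · simpa using l.le_opNorm (1, 0)

theorem expAlg_differentiable {H : C(ℂ × ℂ, ℂ)} (hH : H ∈ expAlg) : Differentiable ℂ H :=
  InA.differentiable ⟨H, Subalgebra.le_topologicalClosure _ hH, fun _ => rfl⟩

theorem fam_expAlg (ℓ : ℂ × ℂ →L[ℂ] ℂ) {H : C(ℂ × ℂ, ℂ)} (hH : H ∈ expAlg) :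
    Fam (fun z => ℓ.smulRight (sgrad (fderiv ℂ H z))) := by
  refine (expAlg_induction (p := fun H : C(ℂ × ℂ, ℂ) => Differentiable ℂ H ∧
    Fam (fun z => ℓ.smulRight (sgrad (fderiv ℂ H z)))) ?_ ?_ ?_ hH).2
  · refine ⟨differentiable_const 0, ?_⟩
    convert fam_zero using 2 with z
    have : fderiv ℂ (⇑(0 : C(ℂ × ℂ, ℂ))) z = 0 := by
      rw [ContinuousMap.coe_zero]
      exact fderiv_const_apply 0
    rw [this]
    ext <;> simp [sgrad]
  · rintro g h ⟨hg, hg'⟩ ⟨hh, hh'⟩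
    refine ⟨hg.add hh, ?_⟩
    convert hg'.add hh' using 2 with z
    rw [ContinuousMap.coe_add, fderiv_add (hg z) (hh z), sgrad_add]
    ext <;> simp
  · intro a l
    have hd : ∀ z, HasFDerivAt (⇑(a • expMap l)) ((a * Complex.exp (l z)) • l) z := by
      intro z
      have := ((l.hasFDerivAt (x := z)).cexp).const_smul a
      rwa [smul_smul] at this
    refine ⟨fun z => (hd z).differentiableAt, ?_⟩
    convert fam_shear ℓ l a using 3 with z
    rw [(hd z).fderiv, sgrad_smul]

theorem exists_family_displacement {Θ : (ℂ × ℂ) × (ℂ × ℂ) → ℂ × ℂ} (hΘ : Differentiable ℂ Θ)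
    (h0 : ∀ z, Θ (0, z) = z) {D : ℂ × ℂ → (ℂ × ℂ →L[ℂ] ℂ × ℂ)}
    (hD : ∀ z, HasFDerivAt (fun w => Θ (w, z)) (D z) 0) {K : Set (ℂ × ℂ)} (hK : IsCompact K)
    {η : ℝ} (hη : ∀ z ∈ K, ‖D z‖ < η) :
    ∃ r > 0, ∀ w, ‖w‖ ≤ r → ∀ z ∈ K, ‖Θ (w, z) - z‖ ≤ η * ‖w‖ := by
  let I : ℂ × ℂ →L[ℂ] (ℂ × ℂ) × (ℂ × ℂ) := ContinuousLinearMap.inl ℂ _ _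
  have hd : ∀ w z, HasFDerivAt (fun w => Θ (w, z)) ((fderiv ℂ Θ (w, z)).comp I) w := by
    intro w z
    exact (hΘ (w, z)).hasFDerivAt.comp w ((hasFDerivAt_id w).prodMk (hasFDerivAt_const z w))
  have hc : Continuous fun p => ‖(fderiv ℂ Θ p).comp I‖ := by
    have := hΘ.continuous_fderiv_complex
    fun_prop
  have h1 : ∀ᶠ w in 𝓝 (0 : ℂ × ℂ), ∀ z ∈ K, ‖(fderiv ℂ Θ (w, z)).comp I‖ < η := by
    refine hK.eventually_forall_of_forall_eventually fun z hz => ?_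
    refine hc.continuousAt.eventually_lt continuousAt_const ?_
    rw [← (hD z).unique (hd 0 z)]
    exact hη z hz
  obtain ⟨r, hr, h2⟩ := Metric.eventually_nhds_iff_ball.1 h1
  refine ⟨r / 2, by positivity, fun w hw z hz => ?_⟩
  have := (convex_ball (0 : ℂ × ℂ) r).norm_image_sub_le_of_norm_hasFDerivWithin_le (𝕜 := ℂ)
    (f := fun w => Θ (w, z)) (C := η) (fun w _ => (hd w z).hasFDerivWithinAt)
    (fun w hw => (h2 w hw z hz).le) (mem_ball_self hr) (y := w) (by simp; linarith)
  simpa [h0] using this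

theorem exists_expAlg_fderiv_small {P : ℂ × ℂ → ℂ} (hP : InA P) {K : Set (ℂ × ℂ)}
    (hK : IsCompact K) {c : ℝ} (hc : 0 ≤ c) (hPK : ∀ z ∈ K, ‖P z‖ < c) {e : ℂ × ℂ}
    (he : c < ‖P e‖) (l : ℂ × ℂ →L[ℂ] ℂ) {ε : ℝ} (hε : 0 < ε) :
    ∃ H ∈ expAlg, fderiv ℂ (H : ℂ × ℂ → ℂ) e = l ∧ ∀ z ∈ K, ‖fderiv ℂ H z‖ < ε := by
  obtain ⟨P', hP', hP'K⟩ := hP.exists_approx (hK.union (isCompact_singleton (x := e)))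
    (show 0 < (‖P e‖ - c) / 3 by linarith)
  set t := (‖P e‖ - c) / 3 with ht
  have ht0 : 0 < t := by rw [ht]; linarith
  have hPe : c + 2 * t < ‖P' e‖ := by
    have h1 := hP'K e (by simp)
    have h2 := norm_sub_norm_le (P e) (P' e)
    rw [norm_sub_rev] at h2
    linarith
  have hPe0 : P' e ≠ 0 := by
    rw [← norm_pos_iff]; linarith
  obtain ⟨θ, hθ0, hθ1, hθ⟩ : ∃ θ : ℝ, 0 ≤ θ ∧ θ < 1 ∧ ∀ z ∈ K, ‖(P' e)⁻¹ * P' z‖ ≤ θ := by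
    refine ⟨(c + t) / ‖P' e‖, by positivity, (div_lt_one (by linarith)).2 (by linarith), ?_⟩
    intro z hz
    rw [norm_mul, norm_inv, inv_mul_eq_div]
    gcongr
    have h1 := hP'K z (by simp [hz])
    have h2 := norm_sub_norm_le (P' z) (P z)
    have h3 := hPK z hz
    linarith
  set Q : C(ℂ × ℂ, ℂ) := (P' e)⁻¹ • P' with hQ
  have hQA : Q ∈ expAlg := Subalgebra.smul_mem _ hP' _
  have hQe : Q e = 1 := by simp [hQ, hPe0]
  have hQK : ∀ z ∈ K, ‖Q z‖ ≤ θ := by simpa [hQ] using hθ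
  set G : C(ℂ × ℂ, ℂ) := Complex.exp (-l e) • expMap l - 1 with hG
  have hGA : G ∈ expAlg :=
    sub_mem (Subalgebra.smul_mem _ (Algebra.subset_adjoin (mem_range_self l)) _) (one_mem _)
  have hGe : G e = 0 := by simp [hG, ← Complex.exp_add]
  have hGd : fderiv ℂ G e = l := by
    have h := ((((l.hasFDerivAt (x := e)).cexp).const_smul (Complex.exp (-l e)))).sub_const 1
    have h' : HasFDerivAt G _ e := h
    rw [h'.fderiv, smul_smul, ← Complex.exp_add]
    simp
  have hQd := expAlg_differentiable hQA
  have hGd' := expAlg_differentiable hGA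
  have hder : ∀ (N : ℕ) z, HasFDerivAt (⇑(Q ^ (N + 1) * G))
      (Q z ^ (N + 1) • fderiv ℂ G z + G z • (((N + 1 : ℕ) : ℂ) * Q z ^ N) • fderiv ℂ Q z) z := by
    intro N z
    have h : HasFDerivAt (⇑(Q ^ (N + 1) * G)) _ z :=
      ((hQd z).hasFDerivAt.pow (N + 1)).mul (hGd' z).hasFDerivAt
    refine h.congr_fderiv ?_
    simp
  obtain ⟨M, hM0, hM⟩ : ∃ M : ℝ, 0 < M ∧ ∀ z ∈ K, ‖fderiv ℂ G z‖ + ‖G z‖ * ‖fderiv ℂ Q z‖ ≤ M := by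
    have h1 := hQd.continuous_fderiv_complex
    have h2 := hGd'.continuous_fderiv_complex
    have h3 : Continuous fun z => ‖fderiv ℂ G z‖ + ‖G z‖ * ‖fderiv ℂ Q z‖ := by fun_prop
    obtain ⟨M, hM⟩ := hK.exists_bound_of_continuousOn h3.continuousOn
    exact ⟨|M| + 1, by positivity, fun z hz => (le_abs_self _).trans ((hM z hz).trans
      ((le_abs_self M).trans (by linarith)))⟩
  have hlim : Tendsto (fun N : ℕ => ((N : ℝ) * θ ^ N + θ ^ N) * M) atTop (𝓝 0) := by
    have h1 := tendsto_self_mul_const_pow_of_lt_one hθ0 hθ1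
    have h2 := tendsto_pow_atTop_nhds_zero_of_lt_one hθ0 hθ1
    simpa using (h1.add h2).mul_const M
  obtain ⟨N, hN⟩ := (hlim.eventually_lt_const hε).exists
  refine ⟨Q ^ (N + 1) * G, mul_mem (pow_mem hQA _) hGA, ?_, fun z hz => ?_⟩
  · rw [(hder N e).fderiv, hQe, hGe, hGd, one_pow, one_smul]
    exact (congrArg (l + ·) (zero_smul ℂ _)).trans (add_zero l)
  · rw [(hder N z).fderiv]
    refine lt_of_le_of_lt ?_ hN
    have hpow : ‖Q z‖ ^ N ≤ θ ^ N := pow_le_pow_left₀ (norm_nonneg _) (hQK z hz) N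
    have hQ1 : ‖Q z‖ ≤ 1 := (hQK z hz).trans hθ1.le
    calc _ ≤ ‖Q z‖ ^ (N + 1) * ‖fderiv ℂ G z‖ + ‖G z‖ * ((N + 1) * ‖Q z‖ ^ N * ‖fderiv ℂ Q z‖) := by
          refine (norm_add_le _ _).trans ?_
          rw [norm_smul, norm_smul, norm_smul, norm_mul, norm_pow, norm_pow, Complex.norm_natCast]
          push_cast
          exact le_rfl
      _ ≤ (1 * θ ^ N) * ‖fderiv ℂ G z‖ + (N * θ ^ N + θ ^ N) * (‖G z‖ * ‖fderiv ℂ Q z‖) := by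
          gcongr ?_ * _ + ?_
          · rw [pow_succ, mul_comm]
            gcongr
          · have : ‖G z‖ * ((N + 1) * ‖Q z‖ ^ N * ‖fderiv ℂ Q z‖)
              = ((N + 1) * ‖Q z‖ ^ N) * (‖G z‖ * ‖fderiv ℂ Q z‖) := by ring
            rw [this]
            gcongr
            nlinarith [Nat.cast_nonneg (α := ℝ) N]
      _ ≤ (N * θ ^ N + θ ^ N) * (‖fderiv ℂ G z‖ + ‖G z‖ * ‖fderiv ℂ Q z‖) := by
          rw [mul_add]
          gcongr
          have : 0 ≤ N * θ ^ N := by positivity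
          linarith
      _ ≤ _ := by gcongr; exact hM z hz

theorem exists_local_move {P : ℂ × ℂ → ℂ} (hP : InA P) {K : Set (ℂ × ℂ)}
    (hK : IsCompact K) {c : ℝ} (hc : 0 ≤ c) (hPK : ∀ z ∈ K, ‖P z‖ < c) {e : ℂ × ℂ}
    (he : c < ‖P e‖) {η : ℝ} (hη : 0 < η) :
    ∃ r > 0, ∀ v, ‖v‖ < r → ∃ τ σ, IsAut τ σ ∧ τ e = e + v ∧
      ∀ z ∈ K, ‖τ z - z‖ ≤ η * ‖v‖ ∧ ‖σ z - z‖ ≤ η * ‖v‖ := by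
  obtain ⟨H, hH, hHe, hHK⟩ := exists_expAlg_fderiv_small hP hK hc hPK he
    (ContinuousLinearMap.snd ℂ ℂ ℂ) (show 0 < η / 4 by positivity)
  obtain ⟨H', hH', hHe', hHK'⟩ := exists_expAlg_fderiv_small hP hK hc hPK he
    (-ContinuousLinearMap.fst ℂ ℂ ℂ) (show 0 < η / 4 by positivity)
  obtain ⟨Θ, Θ', hΘ, hΘ', ha, h0, h0', hd, hd'⟩ :=
    (fam_expAlg (ContinuousLinearMap.fst ℂ ℂ ℂ) hH).add
      (fam_expAlg (ContinuousLinearMap.snd ℂ ℂ ℂ) hH')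
  have hDK : ∀ z ∈ K, ‖(ContinuousLinearMap.fst ℂ ℂ ℂ).smulRight (sgrad (fderiv ℂ H z))
      + (ContinuousLinearMap.snd ℂ ℂ ℂ).smulRight (sgrad (fderiv ℂ H' z))‖ < η / 2 := by
    intro z hz
    refine (norm_add_le _ _).trans_lt ?_
    rw [ContinuousLinearMap.norm_smulRight_apply, ContinuousLinearMap.norm_smulRight_apply]
    have h1 := (norm_sgrad_le _).trans_lt (hHK z hz)
    have h2 := (norm_sgrad_le _).trans_lt (hHK' z hz)
    have h3 := ContinuousLinearMap.norm_fst_le ℂ ℂ ℂ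
    have h4 := ContinuousLinearMap.norm_snd_le ℂ ℂ ℂ
    nlinarith [norm_nonneg (sgrad (fderiv ℂ H z)), norm_nonneg (sgrad (fderiv ℂ H' z))]
  obtain ⟨r₁, hr₁, h1⟩ := exists_family_displacement hΘ h0 hd hK hDK
  obtain ⟨r₂, hr₂, h2⟩ := exists_family_displacement hΘ' h0' hd' hK
    (fun z hz => by rw [norm_neg]; exact hDK z hz)
  set F : ℂ × ℂ → ℂ × ℂ := fun w => Θ (w, e) with hF
  have hFd : Differentiable ℂ F := hΘ.comp (differentiable_id.prodMk (differentiable_const e))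
  have hF0 : fderiv ℂ F 0 = ContinuousLinearMap.id ℂ (ℂ × ℂ) := by
    rw [(hd e).fderiv]
    change _ + _ = _
    rw [hHe, hHe']
    ext <;> simp [sgrad]
  obtain ⟨r₃, hr₃, h3⟩ : ∃ r > 0, ∀ w ∈ ball (0 : ℂ × ℂ) r,
      ‖fderiv ℂ F w - ContinuousLinearMap.id ℂ (ℂ × ℂ)‖ < 1 / 2 := by
    refine Metric.eventually_nhds_iff_ball.1 ?_
    have := hFd.continuous_fderiv_complex
    refine ContinuousAt.eventually_lt (by fun_prop) continuousAt_const ?_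
    rw [hF0]
    simp
  refine ⟨min (min r₁ r₂) r₃ / 2, by positivity, fun v hv => ?_⟩
  have hv1 : 2 * ‖v‖ < r₁ := by
    have := (min_le_left (min r₁ r₂) r₃).trans (min_le_left _ _); linarith
  have hv2 : 2 * ‖v‖ < r₂ := by
    have := (min_le_left (min r₁ r₂) r₃).trans (min_le_right _ _); linarith
  have hv3 : 2 * ‖v‖ < r₃ := by
    have := (min_le_right (min r₁ r₂) r₃); linarith
  obtain ⟨w, hw, hwe⟩ : ∃ w, ‖w‖ ≤ 2 * ‖v‖ ∧ F w = e + v := by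
    rcases eq_or_ne v 0 with rfl | hv0
    · exact ⟨0, by simp, by simp [hF, h0]⟩
    · obtain ⟨w, hw, hwe, -⟩ := exists_eq_of_fderiv_near (p := 0) (w := e + v) hFd
        (show 0 < 2 * ‖v‖ by positivity) one_pos (ContinuousLinearEquiv.refl ℂ (ℂ × ℂ))
        ContinuousLinearMap.norm_id_le
        (fun x hx => by
          have := (h3 x (closedBall_subset_ball hv3 hx)).le
          simpa using this)
        (by simp [hF, h0])
      exact ⟨w, by simpa using hw, hwe⟩
  refine ⟨_, _, ha w, hwe, fun z hz => ⟨(h1 w (by linarith) z hz).trans ?_,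
    (h2 w (by linarith) z hz).trans ?_⟩⟩ <;> nlinarith

/-- `e` can be moved to `e'` by an automorphism displacing the points near `K` by at
most `ε`; here `δ` bounds the size of the neighbourhoods of `K` under control. -/
def Reach (K : Set (ℂ × ℂ)) (δ ε : ℝ) (e e' : ℂ × ℂ) : Prop :=
  ∃ τ σ, IsAut τ σ ∧ τ e = e' ∧ ∀ s z, (∃ x ∈ K, dist z x ≤ s) → s + ε ≤ δ →
    dist (τ z) z ≤ ε ∧ dist (σ z) z ≤ ε

theorem Reach.symm {K : Set (ℂ × ℂ)} {δ ε : ℝ} {e e' : ℂ × ℂ} (h : Reach K δ ε e e') :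
    Reach K δ ε e' e := by
  obtain ⟨τ, σ, ha, he, hd⟩ := h
  exact ⟨σ, τ, ha.symm, by rw [← he, ha.left_inv], fun s z hz hs => (hd s z hz hs).symm⟩

theorem Reach.trans {K : Set (ℂ × ℂ)} {δ ε ε' : ℝ} {e e' e'' : ℂ × ℂ} (h : Reach K δ ε e e')
    (h' : Reach K δ ε' e' e'') (hε : 0 ≤ ε) (hε' : 0 ≤ ε') : Reach K δ (ε + ε') e e'' := by
  obtain ⟨τ, σ, ha, he, hd⟩ := h
  obtain ⟨τ', σ', ha', he', hd'⟩ := h'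
  refine ⟨_, _, ha'.comp ha, by rw [he, he'], fun s z ⟨x, hx, hxz⟩ hs => ⟨?_, ?_⟩⟩
  · have h1 := (hd s z ⟨x, hx, hxz⟩ (by linarith)).1
    have h2 := (hd' (s + ε) (τ z) ⟨x, hx, (dist_triangle _ z _).trans (by linarith)⟩
      (by linarith)).1
    have := dist_triangle (τ' (τ z)) (τ z) z
    linarith
  · have h1 := (hd' s z ⟨x, hx, hxz⟩ (by linarith)).2
    have h2 := (hd (s + ε') (σ' z) ⟨x, hx, (dist_triangle _ z _).trans (by linarith)⟩
      (by linarith)).2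
    have := dist_triangle (σ (σ' z)) (σ' z) z
    linarith

theorem Reach.mono {K : Set (ℂ × ℂ)} {δ δ' ε ε' : ℝ} {e e' : ℂ × ℂ} (h : Reach K δ ε e e')
    (hδ : δ' ≤ δ) (hε : ε ≤ ε') : Reach K δ' ε' e e' := by
  obtain ⟨τ, σ, ha, he, hd⟩ := h
  refine ⟨τ, σ, ha, he, fun s z hz hs => ?_⟩
  have := hd s z hz (by linarith)
  exact ⟨this.1.trans hε, this.2.trans hε⟩

theorem reach_refl (K : Set (ℂ × ℂ)) (δ : ℝ) (e : ℂ × ℂ) : Reach K δ 0 e e :=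
  ⟨_, _, isAut_id, rfl, fun s z _ _ => by simp⟩

theorem reach_of_lt (K : Set (ℂ × ℂ)) {δ ε : ℝ} (h : δ < ε) (e e' : ℂ × ℂ) :
    Reach K δ ε e e' := by
  refine ⟨_, _, isAut_add_const (e' - e), by simp, fun s z ⟨x, _, hx⟩ hs => ?_⟩
  have := dist_nonneg.trans hx
  linarith

theorem reach_of_isPreconnected {K U : Set (ℂ × ℂ)} {δ : ℝ} (hU : IsOpen U)
    (hloc : ∀ x ∈ U, ∀ η > 0, ∃ r > 0, ∀ v, ‖v‖ < r → Reach K δ (η * ‖v‖) x (x + v))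
    {S : Set (ℂ × ℂ)} (hS : IsPreconnected S) (hSU : S ⊆ U) {e e' : ℂ × ℂ} (he : e ∈ S)
    (he' : e' ∈ S) {ε : ℝ} (hε : 0 < ε) : Reach K δ ε e e' := by
  set A : ℂ × ℂ → Set ℝ := fun x => {t | 0 ≤ t ∧ Reach K δ t e x} with hA
  set d : ℂ × ℂ → ℝ := fun x => sInf (A x) with hd
  have hne : ∀ x, (A x).Nonempty := fun x =>
    ⟨max (δ + 1) 0, le_max_right _ _, reach_of_lt K ((lt_add_one δ).trans_le (le_max_left _ _)) e x⟩
  have hbdd : ∀ x, BddBelow (A x) := fun x => ⟨0, fun t ht => ht.1⟩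
  have hle : ∀ x y t, 0 ≤ t → Reach K δ t x y → d y ≤ d x + t := by
    intro x y t ht h
    refine le_of_forall_pos_lt_add fun ε hε => ?_
    obtain ⟨u, hu, hux⟩ := exists_lt_of_csInf_lt (hne x) (lt_add_of_pos_right (d x) hε)
    have : d y ≤ u + t := csInf_le (hbdd y) ⟨add_nonneg hu.1 ht, hu.2.trans h hu.1 ht⟩
    linarith
  have hder : ∀ x ∈ U, HasFDerivAt d (0 : ℂ × ℂ →L[ℝ] ℝ) x := by
    intro x hx
    rw [hasFDerivAt_iff_isLittleO_nhds_zero, Asymptotics.isLittleO_iff]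
    intro η hη
    obtain ⟨r, hr, h⟩ := hloc x hx η hη
    filter_upwards [Metric.ball_mem_nhds (0 : ℂ × ℂ) hr] with v hv
    have h1 := h v (by simpa using hv)
    have h0 : 0 ≤ η * ‖v‖ := by positivity
    have h2 := hle _ _ _ h0 h1
    have h3 := hle _ _ _ h0 h1.symm
    rw [zero_apply, sub_zero, Real.norm_eq_abs, abs_le]
    constructor <;> linarith
  have hV := hS.subset_connectedComponentIn he hSU
  have hVU := connectedComponentIn_subset U e
  have heq := hU.connectedComponentIn.is_const_of_fderiv_eq_zero (𝕜 := ℝ) (f := d)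
    isPreconnected_connectedComponentIn
    (fun x hx => (hder x (hVU hx)).differentiableAt.differentiableWithinAt)
    (fun x hx => (hder x (hVU hx)).fderiv) (hV he) (hV he')
  have h0 : d e ≤ 0 := csInf_le (hbdd e) ⟨le_rfl, reach_refl K δ e⟩
  obtain ⟨t, ht, htε⟩ := exists_lt_of_csInf_lt (hne e') (show d e' < ε by linarith)
  exact ht.2.mono le_rfl htε.le

/-- `e` can be moved to `e'` by automorphisms arbitrarily close to the identity on `K`. -/
def Mv (K : Set (ℂ × ℂ)) (e e' : ℂ × ℂ) : Prop := ∃ δ > 0, ∀ ε > 0, Reach K δ ε e e'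

theorem Mv.refl (K : Set (ℂ × ℂ)) (e : ℂ × ℂ) : Mv K e e :=
  ⟨1, one_pos, fun _ hε => (reach_refl K 1 e).mono le_rfl hε.le⟩

theorem Mv.trans {K : Set (ℂ × ℂ)} {e e' e'' : ℂ × ℂ} (h : Mv K e e') (h' : Mv K e' e'') :
    Mv K e e'' := by
  obtain ⟨δ, hδ, h⟩ := h
  obtain ⟨δ', hδ', h'⟩ := h'
  refine ⟨min δ δ', lt_min hδ hδ', fun ε hε => ?_⟩
  have := ((h (ε / 2) (by positivity)).mono (min_le_left δ δ') le_rfl).trans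
    ((h' (ε / 2) (by positivity)).mono (min_le_right δ δ') le_rfl) (by positivity) (by positivity)
  simpa using this

theorem Mv.exists_isAut {K : Set (ℂ × ℂ)} {e e' : ℂ × ℂ} (h : Mv K e e') {ε : ℝ} (hε : 0 < ε) :
    ∃ τ σ, IsAut τ σ ∧ τ e = e' ∧ ∀ z ∈ K, dist (τ z) z ≤ ε ∧ dist (σ z) z ≤ ε := by
  obtain ⟨δ, hδ, h⟩ := h
  obtain ⟨τ, σ, ha, he, hd⟩ := h (min ε δ) (lt_min hε hδ)
  refine ⟨τ, σ, ha, he, fun z hz => ?_⟩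
  have := hd 0 z ⟨z, hz, by simp⟩ (by simp)
  exact ⟨this.1.trans (min_le_left _ _), this.2.trans (min_le_left _ _)⟩

theorem mv_of_isPreconnected {P : ℂ × ℂ → ℂ} (hP : InA P) {K : Set (ℂ × ℂ)}
    (hK : IsCompact K) {c : ℝ} (hc : 0 ≤ c) (hPK : ∀ z ∈ K, ‖P z‖ < c) {S : Set (ℂ × ℂ)}
    (hS : IsPreconnected S) (hSP : ∀ z ∈ S, c < ‖P z‖) {e e' : ℂ × ℂ} (he : e ∈ S)
    (he' : e' ∈ S) : Mv K e e' := by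
  have hPc := hP.continuous
  obtain ⟨δ, hδ, hδK⟩ := hK.exists_cthickening_subset_open
    (isOpen_lt hPc.norm continuous_const) hPK
  refine ⟨δ, hδ, fun ε hε => ?_⟩
  refine reach_of_isPreconnected (isOpen_lt continuous_const hPc.norm) ?_ hS hSP he he' hε
  intro x hx η hη
  obtain ⟨r, hr, h⟩ := exists_local_move hP (hK.cthickening (r := δ)) hc hδK hx hη
  refine ⟨r, hr, fun v hv => ?_⟩
  obtain ⟨τ, σ, ha, hxv, hd⟩ := h v hv
  refine ⟨τ, σ, ha, hxv, fun s z ⟨y, hy, hyz⟩ hs => ?_⟩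
  have h0 : 0 ≤ η * ‖v‖ := by positivity
  rw [dist_eq_norm, dist_eq_norm]
  exact hd z (mem_cthickening_of_dist_le z y δ K hy (by linarith))

theorem exists_coord (e : ℂ × ℂ) : ∃ (l : ℂ × ℂ →L[ℂ] ℂ) (v : ℂ × ℂ), v ≠ 0 ∧ l v = 0 ∧
    ‖l e‖ = ‖e‖ ∧ ∀ z, ‖l z‖ ≤ ‖z‖ := by
  rcases le_total ‖e.1‖ ‖e.2‖ with h | h
  · exact ⟨ContinuousLinearMap.snd ℂ ℂ ℂ, (1, 0), by simp, by simp, by simp [Prod.norm_def, h],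
      fun z => norm_snd_le z⟩
  · exact ⟨ContinuousLinearMap.fst ℂ ℂ ℂ, (0, 1), by simp, by simp, by simp [Prod.norm_def, h],
      fun z => norm_fst_le z⟩

theorem exists_large_on_line {B Ψ : ℂ × ℂ → ℂ × ℂ} (hB : IsAut B Ψ) {e v : ℂ × ℂ} (hv : v ≠ 0)
    (he : (B e).2 ≠ 0) {m T : ℝ} (hm : 0 < m) : ∃ ζ : ℂ, (B (e + ζ • v)).2 ≠ 0 ∧
      (m < ‖(B (e + ζ • v)).2‖ ∨ T < ‖(B (e + ζ • v)).1‖) := by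
  by_contra! hcon
  have hd : Differentiable ℂ fun ζ : ℂ => B (e + ζ • v) :=
    hB.left.differentiable.comp (by fun_prop)
  have hf : ∀ ζ : ℂ, ‖(B (e + ζ • v)).2‖ ≤ m := by
    intro ζ
    by_cases h : (B (e + ζ • v)).2 = 0
    · rw [h, norm_zero]; exact hm.le
    · exact (hcon ζ h).1
  have hfc : ∀ ζ ξ : ℂ, (B (e + ζ • v)).2 = (B (e + ξ • v)).2 := by
    refine (hd.snd).apply_eq_apply_of_bounded ?_
    exact isBounded_iff_forall_norm_le.2 ⟨m, by rintro _ ⟨ζ, rfl⟩; exact hf ζ⟩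
  have hρ : ∀ ζ : ℂ, ‖(B (e + ζ • v)).1‖ ≤ T := by
    intro ζ
    refine (hcon ζ ?_).2
    rw [hfc ζ 0]
    simpa using he
  have hρc : ∀ ζ ξ : ℂ, (B (e + ζ • v)).1 = (B (e + ξ • v)).1 := by
    refine (hd.fst).apply_eq_apply_of_bounded ?_
    exact isBounded_iff_forall_norm_le.2 ⟨T, by rintro _ ⟨ζ, rfl⟩; exact hρ ζ⟩
  have h1 : B (e + (0 : ℂ) • v) = B (e + (1 : ℂ) • v) := Prod.ext (hρc 0 1) (hfc 0 1)
  have h2 := congrArg Ψ h1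
  rw [hB.left_inv, hB.left_inv] at h2
  simp at h2
  exact hv h2

theorem mv_line {f : ℂ × ℂ → ℂ} (hf : InA f) {K : Set (ℂ × ℂ)} (hK : IsCompact K) {R m : ℝ}
    (hKR : ∀ z ∈ K, ‖z‖ ≤ R ∨ f z = 0) (hfK : ∀ z ∈ K, ‖f z‖ < m) {e v : ℂ × ℂ}
    (hR0 : 0 ≤ R) (hR : R < ‖e‖) {l : ℂ × ℂ →L[ℂ] ℂ} (hlv : l v = 0) (hle : ‖l e‖ = ‖e‖)
    (hl : ∀ z, ‖l z‖ ≤ ‖z‖) (he : f e ≠ 0) {ζ : ℂ} (hζ : f (e + ζ • v) ≠ 0) :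
    Mv K e (e + ζ • v) := by
  have hγd : Differentiable ℂ fun ξ : ℂ => f (e + ξ • v) :=
    hf.differentiable.comp (by fun_prop)
  have hcount := countable_setOf_eq_zero hγd (z₀ := 0) (by simpa using he)
  have hpc := hcount.isPathConnected_compl_of_one_lt_rank (by
    rw [Complex.rank_real_complex]; exact Nat.one_lt_ofNat)
  obtain ⟨γ, hγ⟩ := hpc.joinedIn 0 (by simpa using he) ζ (by simpa using hζ)
  set S : Set (ℂ × ℂ) := range fun t => e + γ t • v with hS
  have hSc : Continuous fun t => e + γ t • v := by fun_prop
  obtain ⟨c, hc, hcS⟩ : ∃ c : ℝ, 0 < c ∧ ∀ z ∈ S, c < ‖f z‖ := by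
    obtain ⟨c, hc, hcS⟩ := (isCompact_range hSc).exists_forall_le'
      hf.continuous.norm.continuousOn (a := 0) (by
        rintro _ ⟨t, rfl⟩
        exact norm_pos_iff.2 (hγ t))
    exact ⟨c / 2, by positivity, fun z hz => (half_lt_self hc).trans_le (hcS z hz)⟩
  obtain ⟨θ, hθ0, hθ1, hθ⟩ : ∃ θ : ℝ, 0 ≤ θ ∧ θ < 1 ∧ ∀ z, ‖z‖ ≤ R → ‖(l e)⁻¹ * l z‖ ≤ θ := by
    refine ⟨R / ‖e‖, by positivity, (div_lt_one (hR0.trans_lt hR)).2 hR, fun z hz => ?_⟩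
    rw [norm_mul, norm_inv, inv_mul_eq_div, hle]
    gcongr
    exact (hl z).trans hz
  have hle0 : ∀ t, l (e + γ t • v) = l e := by
    intro t; simp [hlv]
  have hl0 : l e ≠ 0 := by
    rw [← norm_pos_iff, hle]
    exact hR0.trans_lt hR
  obtain ⟨N, hN⟩ := (((tendsto_pow_atTop_nhds_zero_of_lt_one hθ0 hθ1).mul_const
    m).eventually_lt_const
    (show 0 * m < c by simpa using hc)).exists
  refine mv_of_isPreconnected (P := fun z => f z * ((l e)⁻¹ * l z) ^ N)
    (hf.mul (((inA_const _).mul (inA_linear l)).pow N)) hK hc.le ?_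
    (isPreconnected_range hSc) ?_ ⟨0, by simp⟩ ⟨1, by simp⟩
  · intro z hz
    rcases hKR z hz with h | h
    · rw [norm_mul, norm_pow, mul_comm]
      refine lt_of_le_of_lt ?_ hN
      gcongr
      · exact hθ z h
      · exact (hfK z hz).le
    · simpa [h] using hc
  · rintro _ ⟨t, rfl⟩
    dsimp only
    rw [hle0, inv_mul_cancel₀ hl0, one_pow, mul_one]
    exact hcS _ ⟨t, rfl⟩

/-- A point outside a ball can be moved to the zero set of the second component. -/
theorem exists_mv_zero {B Ψ : ℂ × ℂ → ℂ × ℂ} (hB : IsAut B Ψ) {R T : ℝ} {e : ℂ × ℂ}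
    (hR0 : 0 ≤ R) (hR : R < ‖e‖) : ∃ q, (B q).2 = 0 ∧
      Mv (closedBall 0 R ∪ (fun t => Ψ (t, 0)) '' closedBall 0 T) e q := by
  set K : Set (ℂ × ℂ) := closedBall 0 R ∪ (fun t => Ψ (t, 0)) '' closedBall 0 T with hKdef
  have hBc := hB.left.differentiable.continuous
  have hΨc := hB.right.differentiable.continuous
  have hK : IsCompact K := (isCompact_closedBall 0 R).union
    ((isCompact_closedBall 0 T).image (by fun_prop))
  by_cases he : (B e).2 = 0
  · exact ⟨e, he, Mv.refl K e⟩
  obtain ⟨m, hm, hmK⟩ : ∃ m : ℝ, 0 < m ∧ ∀ z ∈ K, ‖B z‖ < m := by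
    obtain ⟨C, hC⟩ := hK.exists_bound_of_continuousOn hBc.continuousOn
    exact ⟨|C| + 1, by positivity, fun z hz => (hC z hz).trans_lt
      ((le_abs_self C).trans_lt (lt_add_one _))⟩
  have hm1 : ∀ z ∈ K, ‖(B z).1‖ < m := fun z hz => (norm_fst_le _).trans_lt (hmK z hz)
  have hm2 : ∀ z ∈ K, ‖(B z).2‖ < m := fun z hz => (norm_snd_le _).trans_lt (hmK z hz)
  obtain ⟨l, v, hv, hlv, hle, hl⟩ := exists_coord e
  obtain ⟨ζ, hζ, hbig⟩ := exists_large_on_line hB hv he hm (T := m)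
  set z₁ := e + ζ • v with hz₁
  have hmv₁ : Mv K e z₁ := by
    refine mv_line hB.left.2 hK ?_ hm2 hR0 hR hlv hle hl he hζ
    rintro z (hz | ⟨t, -, rfl⟩)
    · exact Or.inl (by simpa using hz)
    · right
      simp [hB.right_inv]
  obtain ⟨z₂, hmv₂, hz₂⟩ : ∃ z₂, Mv K z₁ z₂ ∧ m < ‖(B z₂).1‖ := by
    rcases hbig with h | h
    · refine ⟨Ψ ((m : ℂ) + 1, (B z₁).2), ?_, ?_⟩
      · refine mv_of_isPreconnected hB.left.2 hK hm.le hm2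
          (isPreconnected_range (f := fun t : ℂ => Ψ (t, (B z₁).2)) (by fun_prop)) ?_
          ⟨(B z₁).1, hB.left_inv z₁⟩ ⟨_, rfl⟩
        rintro _ ⟨t, rfl⟩
        simpa [hB.right_inv] using h
      · rw [hB.right_inv]
        have : ((m : ℂ) + 1) = ((m + 1 : ℝ) : ℂ) := by push_cast; rfl
        rw [this, Complex.norm_real, Real.norm_of_nonneg (by positivity)]
        linarith
    · exact ⟨z₁, Mv.refl K z₁, h⟩
  refine ⟨Ψ ((B z₂).1, 0), by rw [hB.right_inv], hmv₁.trans (hmv₂.trans ?_)⟩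
  refine mv_of_isPreconnected hB.left.1 hK hm.le hm1
    (isPreconnected_range (f := fun s : ℂ => Ψ ((B z₂).1, s)) (by fun_prop)) ?_
    ⟨(B z₂).2, hB.left_inv z₂⟩ ⟨_, rfl⟩
  rintro _ ⟨t, rfl⟩
  simpa [hB.right_inv] using hz₂

theorem exists_entire_limit {E G : Type*} [NormedAddCommGroup E] [NormedSpace ℂ E]
    [NormedAddCommGroup G] [NormedSpace ℂ G] [CompleteSpace G] {F : ℕ → E → G}
    (hF : ∀ n, Differentiable ℂ (F n))
    (h : ∀ R : ℝ, ∀ᶠ n in atTop, ∀ x ∈ closedBall (0 : E) R, ‖F (n + 1) x - F n x‖ ≤ (1 / 2) ^ n) :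
    ∃ f, Differentiable ℂ f ∧ ∀ R : ℝ, TendstoUniformlyOn F f atTop (closedBall 0 R) := by
  have hstep : ∀ (x : E) (N : ℕ), (∀ n ≥ N, ‖F (n + 1) x - F n x‖ ≤ (1 / 2) ^ n) →
      ∀ n, dist (F (N + n) x) (F (N + (n + 1)) x) ≤ 2 * (1 / 2) ^ N / 2 / 2 ^ n := by
    intro x N hN n
    rw [dist_comm, dist_eq_norm]
    refine (hN (N + n) (by omega)).trans (le_of_eq ?_)
    rw [pow_add]
    field_simp
    rw [← mul_pow]
    norm_num
  have hlim : ∀ x, ∃ y, Tendsto (fun n => F n x) atTop (𝓝 y) := by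
    intro x
    obtain ⟨N, hN⟩ := eventually_atTop.1 (h ‖x‖)
    obtain ⟨y, hy⟩ := cauchySeq_tendsto_of_complete
      (cauchySeq_of_le_geometric_two (hstep x N fun n hn => hN n hn x (by simp)))
    refine ⟨y, ?_⟩
    rw [← tendsto_add_atTop_iff_nat N]
    simpa only [add_comm] using hy
  choose f hf using hlim
  have hu : ∀ R : ℝ, TendstoUniformlyOn F f atTop (closedBall 0 R) := by
    intro R
    obtain ⟨N, hN⟩ := eventually_atTop.1 (h R)
    rw [Metric.tendstoUniformlyOn_iff]
    intro ε hε
    have h0 : Tendsto (fun n : ℕ => 2 * (1 / 2 : ℝ) ^ n) atTop (𝓝 0) := by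
      simpa using (tendsto_pow_atTop_nhds_zero_of_lt_one (r := (1 / 2 : ℝ)) (by norm_num)
        (by norm_num)).const_mul 2
    filter_upwards [eventually_ge_atTop N, h0.eventually_lt_const hε] with n hn hn' x hx
    rw [dist_comm]
    refine lt_of_le_of_lt ?_ hn'
    refine dist_le_of_le_geometric_two_of_tendsto₀
      (hstep x n fun m hm => hN m (hn.trans hm) x hx) ?_
    have := (tendsto_add_atTop_iff_nat n).2 (hf x)
    simpa only [add_comm] using this
  exact ⟨f, (differentiable_of_tendstoUniformlyOn_closedBall hF hu).1, hu⟩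

theorem tendstoUniformlyOn_comp_closedBall {E F G : Type*} [NormedAddCommGroup E]
    [ProperSpace E] [NormedAddCommGroup F] [ProperSpace F] [NormedAddCommGroup G]
    {φ : ℕ → F → G} {φ' : F → G} {ρ : ℕ → E → F} {ρ' : E → F}
    (hφ : ∀ R : ℝ, TendstoUniformlyOn φ φ' atTop (closedBall 0 R))
    (hρ : ∀ R : ℝ, TendstoUniformlyOn ρ ρ' atTop (closedBall 0 R))
    (hφc : Continuous φ') (hρc : Continuous ρ') (R : ℝ) :
    TendstoUniformlyOn (fun n z => φ n (ρ n z)) (fun z => φ' (ρ' z)) atTop (closedBall 0 R) := by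
  obtain ⟨M, -, hM⟩ := exists_norm_le_of_continuous hρc R
  have huc := (isCompact_closedBall (0 : F) (M + 1)).uniformContinuousOn_of_continuous
    hφc.continuousOn
  rw [Metric.uniformContinuousOn_iff] at huc
  rw [Metric.tendstoUniformlyOn_iff]
  intro ε hε
  obtain ⟨δ, hδ, huc⟩ := huc (ε / 2) (by positivity)
  filter_upwards [Metric.tendstoUniformlyOn_iff.1 (hρ R) (min δ 1) (by positivity),
    Metric.tendstoUniformlyOn_iff.1 (hφ (M + 1)) (ε / 2) (by positivity)] with n h1 h2 z hz
  have h3 := h1 z hz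
  have h4 : ‖ρ' z‖ ≤ M := hM z hz
  have h5 : ‖ρ n z‖ ≤ M + 1 := by
    have := norm_sub_norm_le (ρ n z) (ρ' z)
    rw [← dist_eq_norm, dist_comm] at this
    have := h3.trans_le (min_le_right _ _)
    linarith
  have h6 := huc (ρ' z) (by simp; linarith) (ρ n z) (by simpa using h5)
    (h3.trans_le (min_le_left _ _))
  have h7 := h2 (ρ n z) (by simpa using h5)
  have := dist_triangle (φ' (ρ' z)) (φ' (ρ n z)) (φ n (ρ n z))
  linarith

/-- One step of the construction: `S` consists of an automorphism, its inverse, and a radius. -/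
def Step (e : ℕ → ℂ × ℂ) (η : ℕ → ℝ) (n : ℕ)
    (S S' : (ℂ × ℂ → ℂ × ℂ) × (ℂ × ℂ → ℂ × ℂ) × ℝ) : Prop :=
  S.2.2 ≤ S'.2.2 ∧ (n : ℝ) + 1 ≤ S'.2.2 ∧ (S'.1 (e n)).2 = 0 ∧ ‖(S'.1 (e n)).1‖ ≤ S'.2.2 ∧
    (∀ z, ‖z‖ ≤ ‖e n‖ / 2 → ‖S'.1 z - S.1 z‖ ≤ (1 / 2) ^ (n + 2)) ∧
    ∀ t : ℂ, ‖t‖ ≤ S.2.2 → ‖S'.2.1 (t, 0) - S.2.1 (t, 0)‖ ≤ η n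

theorem exists_step {e : ℕ → ℂ × ℂ} {η : ℕ → ℝ} (he : ∀ j, e j ≠ 0) (hη : ∀ j, 0 < η j) (n : ℕ)
    {S : (ℂ × ℂ → ℂ × ℂ) × (ℂ × ℂ → ℂ × ℂ) × ℝ} (hS : IsAut S.1 S.2.1) :
    ∃ S' : (ℂ × ℂ → ℂ × ℂ) × (ℂ × ℂ → ℂ × ℂ) × ℝ, IsAut S'.1 S'.2.1 ∧ Step e η n S S' := by
  obtain ⟨B, Ψ, T⟩ := S
  dsimp only at hS
  have hR : ‖e n‖ / 2 < ‖e n‖ := half_lt_self (norm_pos_iff.2 (he n))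
  obtain ⟨q, hq, hmv⟩ := exists_mv_zero hS (T := T) (by positivity) hR
  have huc := (isCompact_closedBall (0 : ℂ × ℂ) (‖e n‖ / 2 + 1)).uniformContinuousOn_of_continuous
    hS.left.differentiable.continuous.continuousOn
  rw [Metric.uniformContinuousOn_iff] at huc
  obtain ⟨δ, hδ, huc⟩ := huc ((1 / 2) ^ (n + 2)) (by positivity)
  obtain ⟨τ, σ, ha, hτ, hd⟩ := hmv.exists_isAut (ε := min (η n) (min (δ / 2) 1))
    (lt_min (hη n) (by positivity))
  refine ⟨(fun z => B (τ z), fun z => σ (Ψ z), max (max T (n + 1)) ‖(B q).1‖), hS.comp ha,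
    (le_max_left _ _).trans (le_max_left _ _), (le_max_right _ _).trans (le_max_left _ _),
    ?_, ?_, ?_, ?_⟩
  · dsimp only
    rw [hτ, hq]
  · dsimp only
    rw [hτ]
    exact le_max_right _ _
  · intro z hz
    have h1 := (hd z (Or.inl (by simpa using hz))).1
    have h2 : dist (τ z) z ≤ δ / 2 := h1.trans ((min_le_right _ _).trans (min_le_left _ _))
    have h3 : dist (τ z) z ≤ 1 := h1.trans ((min_le_right _ _).trans (min_le_right _ _))
    rw [← dist_eq_norm]
    refine (huc (τ z) ?_ z ?_ (by linarith)).le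
    · rw [mem_closedBall_zero_iff]
      rw [dist_eq_norm] at h3
      have := norm_sub_norm_le (τ z) z
      linarith
    · rw [mem_closedBall_zero_iff]
      linarith
  · intro t ht
    rw [← dist_eq_norm]
    exact (hd (Ψ (t, 0)) (Or.inr ⟨t, by simpa using ht, rfl⟩)).2.trans (min_le_left _ _)

theorem exists_fast_sequence {δ : ℕ → ℝ} (hδ : ∀ j, 0 < δ j) : ∃ η : ℕ → ℝ, (∀ n, 0 < η n) ∧
    (∀ n, η n ≤ (1 / 2) ^ n) ∧ ∀ j n, η (j + 1 + n) ≤ δ j / 2 / 2 ^ n := by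
  have hm : ∀ l, 0 < min 1 (δ l) := fun l => lt_min one_pos (hδ l)
  have h1 : ∀ n, ∏ l ∈ Finset.range n, min 1 (δ l) ≤ 1 := fun n =>
    Finset.prod_le_one (fun l _ => (hm l).le) fun l _ => min_le_left _ _
  refine ⟨fun n => (1 / 2) ^ n * ∏ l ∈ Finset.range n, min 1 (δ l),
    fun n => mul_pos (by positivity) (Finset.prod_pos fun l _ => hm l),
    fun n => mul_le_of_le_one_right (by positivity) (h1 n), fun j n => ?_⟩
  have h2 : ∏ l ∈ Finset.range (j + 1 + n), min 1 (δ l) ≤ δ j := by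
    rw [← Finset.mul_prod_erase _ _ (Finset.mem_range.2 (show j < j + 1 + n by omega))]
    refine (mul_le_of_le_one_right (hm j).le ?_).trans (min_le_right _ _)
    exact Finset.prod_le_one (fun l _ => (hm l).le) fun l _ => min_le_left _ _
  have h3 : (1 / 2 : ℝ) ^ (j + 1 + n) ≤ 1 / 2 / 2 ^ n := by
    rw [pow_add, pow_succ, div_div, one_div_pow (2 : ℝ) n, one_div_pow]
    have : (1 : ℝ) ≤ 2 ^ j := one_le_pow₀ (by norm_num)
    rw [div_mul_div_comm, div_mul_div_comm]
    gcongr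
    · norm_num
    · linarith
  calc _ ≤ 1 / 2 / 2 ^ n * δ j := by
        dsimp only
        gcongr
        exact Finset.prod_nonneg fun l _ => (hm l).le
    _ = _ := by ring

theorem exists_embedded_line_near {e : ℕ → ℂ × ℂ} {δ : ℕ → ℝ} (he : ∀ j, e j ≠ 0)
    (hδ : ∀ j, 0 < δ j) (hlim : Tendsto (fun j => ‖e j‖) atTop atTop) :
    ∃ (f ρ : ℂ × ℂ → ℂ) (φ : ℂ → ℂ × ℂ) (k : ℂ × ℂ → ℂ × ℂ), Differentiable ℂ f ∧
      Differentiable ℂ ρ ∧ Differentiable ℂ φ ∧ Differentiable ℂ k ∧ (∀ t, f (φ t) = 0) ∧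
      (∀ t, ρ (φ t) = t) ∧ (∀ z, z = φ (ρ z) + f z • k z) ∧ f 0 ≠ 0 ∧ f 0 ≠ 1 ∧
      ∀ j, ∃ z, ‖z - e j‖ ≤ δ j ∧ f z = 0 := by
  obtain ⟨η, hη, hη1, hηδ⟩ := exists_fast_sequence hδ
  obtain ⟨S, hS0, hSA, hstep⟩ : ∃ S : ℕ → (ℂ × ℂ → ℂ × ℂ) × (ℂ × ℂ → ℂ × ℂ) × ℝ,
      S 0 = (fun z => (z.2, z.1 + (-1)), fun z => (z.2 + 1, z.1), 0) ∧
      (∀ n, IsAut (S n).1 (S n).2.1) ∧ ∀ n, Step e η n (S n) (S (n + 1)) := by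
    let X := {S : (ℂ × ℂ → ℂ × ℂ) × (ℂ × ℂ → ℂ × ℂ) × ℝ // IsAut S.1 S.2.1}
    have hex : ∀ n (S : X), ∃ S' : X, Step e η n S.1 S'.1 := by
      intro n S
      obtain ⟨S', hS', h⟩ := exists_step he hη n S.2
      exact ⟨⟨S', hS'⟩, h⟩
    choose g hg using hex
    let S₀ : X := ⟨(fun z => (z.2, z.1 + (-1)), fun z => (z.2 + 1, z.1), 0),
      ⟨⟨inA_snd, inA_fst.add (inA_const _)⟩, ⟨inA_snd.add (inA_const _), inA_fst⟩,
        fun z => by simp, fun z => by simp⟩⟩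
    let S : ℕ → X := fun n => Nat.rec S₀ (fun n S => g n S) n
    exact ⟨fun n => (S n).1, rfl, fun n => (S n).2, fun n => hg n (S n)⟩
  have hBd : ∀ n, Differentiable ℂ (S n).1 := fun n => (hSA n).left.differentiable
  have hΨd : ∀ n, Differentiable ℂ (S n).2.1 := fun n => (hSA n).right.differentiable
  have hφd : ∀ n, Differentiable ℂ fun t : ℂ => (S n).2.1 (t, 0) := fun n =>
    (hΨd n).comp (by fun_prop)
  have hpow : ∀ n : ℕ, (1 / 2 : ℝ) ^ (n + 2) ≤ (1 / 2) ^ n := fun n =>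
    pow_le_pow_of_le_one (by norm_num) (by norm_num) (by omega)
  obtain ⟨B, hB, hBlim⟩ := exists_entire_limit hBd (by
    intro R
    filter_upwards [hlim.eventually_ge_atTop (2 * R)] with n hn x hx
    refine ((hstep n).2.2.2.2.1 x ?_).trans (hpow n)
    rw [mem_closedBall_zero_iff] at hx
    linarith)
  have hTmono : Monotone fun n => (S n).2.2 := monotone_nat_of_le_succ fun n => (hstep n).1
  have hTn : ∀ n : ℕ, (n : ℝ) ≤ (S n).2.2 := by
    intro n
    cases n with
    | zero => rw [hS0]; simp
    | succ n => simpa using (hstep n).2.1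
  obtain ⟨φ, hφ, hφlim⟩ := exists_entire_limit hφd (by
    intro R
    obtain ⟨N, hN⟩ := exists_nat_gt R
    filter_upwards [eventually_ge_atTop N] with n hn x hx
    refine ((hstep n).2.2.2.2.2 x ?_).trans (hη1 n)
    rw [mem_closedBall_zero_iff] at hx
    have h1 := hTn n
    have h2 : (N : ℝ) ≤ n := by exact_mod_cast hn
    linarith)
  have hBpt : ∀ z, Tendsto (fun n => (S n).1 z) atTop (𝓝 (B z)) := fun z =>
    (hBlim ‖z‖).tendsto_at (by simp)
  have hφpt : ∀ t, Tendsto (fun n => (S n).2.1 (t, 0)) atTop (𝓝 (φ t)) := fun t =>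
    (hφlim ‖t‖).tendsto_at (by simp)
  have hBφ : ∀ t, B (φ t) = (t, 0) := by
    intro t
    have h1 := (tendstoUniformlyOn_comp_closedBall hBlim hφlim hB.continuous hφ.continuous
      ‖t‖).tendsto_at (x := t) (by simp)
    simp only [(hSA _).right_inv] at h1
    exact tendsto_nhds_unique h1 tendsto_const_nhds
  have hB0 : ‖(B 0).2 + 1‖ ≤ 1 / 2 := by
    have h1 : dist ((S 0).1 0) (B 0) ≤ 1 / 2 := by
      refine dist_le_of_le_geometric_two_of_tendsto₀ (fun n => ?_) (hBpt 0)
      rw [dist_comm, dist_eq_norm]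
      refine ((hstep n).2.2.2.2.1 0 (by rw [norm_zero]; positivity)).trans (le_of_eq ?_)
      rw [one_div_pow, pow_add]
      field_simp
    rw [dist_comm, dist_eq_norm] at h1
    have h2 := (norm_snd_le _).trans h1
    rw [hS0] at h2
    simpa using h2
  have hBne0 : (B 0).2 ≠ 0 := by
    intro h; rw [h] at hB0; norm_num at hB0
  have hρlim : ∀ R : ℝ, TendstoUniformlyOn (fun n z => ((S n).1 z).1) (fun z => (B z).1) atTop
      (closedBall 0 R) := fun R => uniformContinuous_fst.comp_tendstoUniformlyOn (hBlim R)
  have hflim : ∀ R : ℝ, TendstoUniformlyOn (fun n z => ((S n).1 z).2) (fun z => (B z).2) atTop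
      (closedBall 0 R) := fun R => uniformContinuous_snd.comp_tendstoUniformlyOn (hBlim R)
  have hk : ∀ n, ∃ k : ℂ × ℂ → ℂ × ℂ, Differentiable ℂ k ∧
      ∀ z, z - (S n).2.1 (((S n).1 z).1, 0) = ((S n).1 z).2 • k z := by
    intro n
    obtain ⟨q, hq, hqe⟩ := exists_differentiable_quotient (hΨd n)
    refine ⟨fun z => q ((((S n).1 z).1, 0), (0, 1), ((S n).1 z).2), hq.comp ?_, fun z => ?_⟩
    · have h1 := (hBd n).fst
      have h2 := (hBd n).snd
      fun_prop
    · rw [sub_eq_iff_eq_add', ← hqe]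
      conv_lhs => rw [← (hSA n).left_inv z]
      ext <;> simp
  choose k hkd hk using hk
  obtain ⟨k', hk'd, hk'⟩ := exists_quotient_of_tendsto (fun n => (hBd n).snd) hkd hk hflim
    (N' := fun z => z - φ (B z).1) (fun R => by
      have h1 := tendstoUniformlyOn_comp_closedBall hφlim hρlim hφ.continuous
        (hB.continuous.fst) R
      have h2 : TendstoUniformlyOn (fun (_ : ℕ) (z : ℂ × ℂ) => z) (fun z => z) atTop
          (closedBall 0 R) := by
        rw [Metric.tendstoUniformlyOn_iff]
        intro ε hε
        simp [hε]
      exact h2.sub h1) hBne0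
  refine ⟨fun z => (B z).2, fun z => (B z).1, φ, k', hB.snd, hB.fst, hφ, hk'd,
    fun t => by simp [hBφ], fun t => by simp [hBφ], fun z => ?_, hBne0, ?_, fun j => ?_⟩
  · rw [← hk']
    simp
  · intro h
    replace h : (B 0).2 = 1 := h
    rw [h] at hB0
    norm_num at hB0
  · obtain ⟨-, -, h1, h2, -, -⟩ := hstep j
    set t := ((S (j + 1)).1 (e j)).1 with ht
    have h3 : (S (j + 1)).2.1 (t, 0) = e j := by
      have : (t, (0 : ℂ)) = (S (j + 1)).1 (e j) := Prod.ext ht h1.symm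
      rw [this, (hSA (j + 1)).left_inv]
    refine ⟨φ t, ?_, by simp [hBφ]⟩
    rw [← dist_eq_norm, dist_comm, ← h3]
    refine dist_le_of_le_geometric_two_of_tendsto₀ (f := fun n => (S (j + 1 + n)).2.1 (t, 0))
      (fun n => ?_) ?_
    · rw [dist_comm, dist_eq_norm]
      refine ((hstep (j + 1 + n)).2.2.2.2.2 t ?_).trans (hηδ j n)
      exact h2.trans (hTmono (by omega))
    · have := (tendsto_add_atTop_iff_nat (j + 1)).2 (hφpt t)
      simpa only [add_comm] using this

theorem eq_of_eq_of_ne_zero {E G : Type*} [NormedAddCommGroup E] [NormedSpace ℂ E]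
    [TopologicalSpace G] [T2Space G] {h : E → ℂ} (hh : Differentiable ℂ h) {x₀ : E}
    (h0 : h x₀ ≠ 0) {A B : E → G} (hA : Continuous A) (hB : Continuous B)
    (hAB : ∀ x, h x ≠ 0 → A x = B x) : A = B := by
  have hd : Dense {x | h x ≠ 0} := by
    intro x
    have hl : Differentiable ℂ fun s : ℂ => h (x + s • (x₀ - x)) := hh.comp (by fun_prop)
    have hc := countable_setOf_eq_zero hl (z₀ := 1) (by simpa using h0)
    have hs := (hc.dense_compl ℝ) 0
    have hcont : Continuous fun s : ℂ => x + s • (x₀ - x) := by fun_prop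
    have := hcont.closure_preimage_subset {x | h x ≠ 0} hs
    simpa using this
  exact hA.ext_on hd hB hAB

theorem exists_parametrization (m : ℕ) {f ρ : ℂ × ℂ → ℂ} {φ : ℂ → ℂ × ℂ} {k : ℂ × ℂ → ℂ × ℂ}
    (hf : Differentiable ℂ f) (hρ : Differentiable ℂ ρ) (hφ : Differentiable ℂ φ)
    (hk : Differentiable ℂ k) (hfφ : ∀ t, f (φ t) = 0) (hρφ : ∀ t, ρ (φ t) = t)
    (hfk : ∀ z, z = φ (ρ z) + f z • k z) :
    ∃ (Φ : (Fin m → ℂ) × ℂ × ℂ × ℂ → (ℂ × ℂ) × (Fin (m + 1) → ℂ) × ℂ)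
      (Ψ : (ℂ × ℂ) × (Fin (m + 1) → ℂ) × ℂ → (Fin m → ℂ) × ℂ × ℂ × ℂ),
      Differentiable ℂ Φ ∧ Differentiable ℂ Ψ ∧ (∀ x, Ψ (Φ x) = x) ∧
      (∀ x, f (Φ x).1 = ∏ i, (Φ x).2.1 i) ∧
      ∀ y, f y.1 = ∏ i, y.2.1 i → (∀ i, y.2.1 i ≠ 0) → Φ (Ψ y) = y := by
  obtain ⟨qf, hqf, hqfe⟩ := exists_differentiable_quotient hf
  obtain ⟨qρ, hqρ, hqρe⟩ := exists_differentiable_quotient hρ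
  obtain ⟨qφ, hqφ, hqφe⟩ := exists_differentiable_quotient hφ
  simp only [smul_eq_mul] at hqfe hqρe hqφe
  let Φ : (Fin m → ℂ) × ℂ × ℂ × ℂ → (ℂ × ℂ) × (Fin (m + 1) → ℂ) × ℂ := fun x =>
    (φ x.2.1 + (∏ i, x.1 i) • x.2.2,
      Fin.snoc (α := fun _ => ℂ) x.1 (qf (φ x.2.1, x.2.2, ∏ i, x.1 i)),
      -qρ (φ x.2.1, x.2.2, ∏ i, x.1 i))
  let Ψ : (ℂ × ℂ) × (Fin (m + 1) → ℂ) × ℂ → (Fin m → ℂ) × ℂ × ℂ × ℂ := fun y =>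
    (fun i => y.2.1 i.castSucc, ρ y.1 + (∏ i : Fin m, y.2.1 i.castSucc) * y.2.2,
      y.2.1 (Fin.last m) • k y.1 - qφ (ρ y.1, y.2.2, ∏ i : Fin m, y.2.1 i.castSucc))
  have hfΦ : ∀ x, f (Φ x).1 = ∏ i, (Φ x).2.1 i := by
    intro x
    simp only [Φ, Fin.prod_univ_castSucc, Fin.snoc_castSucc, Fin.snoc_last]
    rw [hqfe, hfφ, zero_add]
  have hΦ : Differentiable ℂ Φ := by
    have hP : Differentiable ℂ fun x : (Fin m → ℂ) × ℂ × ℂ × ℂ => ∏ i, x.1 i := by fun_prop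
    have hφ' : Differentiable ℂ fun x : (Fin m → ℂ) × ℂ × ℂ × ℂ => φ x.2.1 :=
      hφ.comp (by fun_prop)
    have hz : Differentiable ℂ fun x : (Fin m → ℂ) × ℂ × ℂ × ℂ =>
        (φ x.2.1, x.2.2, ∏ i, x.1 i) := hφ'.prodMk (Differentiable.prodMk (by fun_prop) hP)
    refine Differentiable.prodMk (hφ'.add (hP.smul (by fun_prop))) (Differentiable.prodMk ?_ ?_)
    · rw [differentiable_pi]
      intro i
      refine Fin.lastCases ?_ (fun i => ?_) i
      · simp only [Fin.snoc_last]
        exact hqf.comp hz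
      · simp only [Fin.snoc_castSucc]
        fun_prop
    · exact (hqρ.comp hz).neg
  have hΨ : Differentiable ℂ Ψ := by
    have hP : Differentiable ℂ fun y : (ℂ × ℂ) × (Fin (m + 1) → ℂ) × ℂ =>
      ∏ i : Fin m, y.2.1 i.castSucc := by fun_prop
    have hρ' : Differentiable ℂ fun y : (ℂ × ℂ) × (Fin (m + 1) → ℂ) × ℂ => ρ y.1 :=
      hρ.comp (by fun_prop)
    have hk' : Differentiable ℂ fun y : (ℂ × ℂ) × (Fin (m + 1) → ℂ) × ℂ => k y.1 :=
      hk.comp (by fun_prop)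
    have h2 : Differentiable ℂ fun y : (ℂ × ℂ) × (Fin (m + 1) → ℂ) × ℂ => y.2.2 := by fun_prop
    have h3 : Differentiable ℂ fun y : (ℂ × ℂ) × (Fin (m + 1) → ℂ) × ℂ => y.2.1 (Fin.last m) := by
      fun_prop
    refine Differentiable.prodMk (by fun_prop) (Differentiable.prodMk (hρ'.add (hP.mul h2)) ?_)
    exact (h3.smul hk').sub (hqφ.comp (hρ'.prodMk (h2.prodMk hP)))
  refine ⟨Φ, Ψ, hΦ, hΨ, ?_, hfΦ, ?_⟩
  · have hP : Differentiable ℂ fun x : (Fin m → ℂ) × ℂ × ℂ × ℂ => ∏ i, x.1 i := by fun_prop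
    have key : (fun x => Ψ (Φ x)) = fun x => x := by
      refine eq_of_eq_of_ne_zero hP (x₀ := (fun _ => 1, 0)) (by simp)
        (hΨ.comp hΦ).continuous continuous_id fun x hx => ?_
      have ht : ρ (Φ x).1 + (∏ i, x.1 i) * (Φ x).2.2 = x.2.1 := by
        simp only [Φ]
        rw [hqρe, hρφ]
        ring
      have h1 : (fun i : Fin m => (Φ x).2.1 i.castSucc) = x.1 := by
        ext i
        simp [Φ]
      have hP1 : ∏ i : Fin m, (Φ x).2.1 i.castSucc = ∏ i, x.1 i := congrArg (fun v => ∏ i, v i) h1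
      have hl : (∏ i, x.1 i) * (Φ x).2.1 (Fin.last m) = f (Φ x).1 := by
        rw [hfΦ, Fin.prod_univ_castSucc, hP1]
      refine Prod.ext h1 (Prod.ext ?_ ?_)
      · simp only [Ψ]
        rw [hP1, ht]
      · simp only [Ψ]
        rw [hP1]
        refine smul_right_injective _ hx ?_
        dsimp only
        have h2 := hqφe (ρ (Φ x).1) (Φ x).2.2 (∏ i, x.1 i)
        rw [ht] at h2
        have h3 := hfk (Φ x).1
        have h4 : (Φ x).1 = φ x.2.1 + (∏ i, x.1 i) • x.2.2 := rfl
        rw [smul_sub, smul_smul, hl, ← add_right_inj (φ x.2.1), ← h4]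
        nth_rw 1 [h2]
        conv_rhs => rw [h3]
        abel
    exact fun x => congrFun key x
  · intro y hy hne
    have hP0 : ∏ i : Fin m, y.2.1 i.castSucc ≠ 0 := Finset.prod_ne_zero_iff.2 fun i _ => hne _
    rw [Fin.prod_univ_castSucc] at hy
    set P := ∏ i : Fin m, y.2.1 i.castSucc with hP
    have h1 : (Φ (Ψ y)).1 = y.1 := by
      simp only [Φ, Ψ]
      rw [← hP, hqφe, smul_sub, smul_smul, ← hy]
      conv_rhs => rw [hfk y.1]
      abel
    have h2 := hqfe (φ (Ψ y).2.1) (Ψ y).2.2 P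
    have h3 := hqρe (φ (Ψ y).2.1) (Ψ y).2.2 P
    have h4 : φ (Ψ y).2.1 + P • (Ψ y).2.2 = y.1 := h1
    rw [h4, hfφ, zero_add, hy] at h2
    rw [h4, hρφ] at h3
    refine Prod.ext h1 (Prod.ext (funext fun i => ?_) ?_)
    · refine Fin.lastCases ?_ (fun i => ?_) i
      · simp only [Φ, Fin.snoc_last]
        exact (mul_left_cancel₀ hP0 h2).symm
      · simp [Φ, Ψ]
    · refine mul_left_cancel₀ hP0 ?_
      have h5 : (Φ (Ψ y)).2.2 = -qρ (φ (Ψ y).2.1, (Ψ y).2.2, P) := rfl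
      have h6 : (Ψ y).2.1 = ρ y.1 + P * y.2.2 := rfl
      rw [h5]
      rw [h6] at h3 ⊢
      linear_combination h3

theorem fderiv_ne_zero_of_embedded_line {f ρ : ℂ × ℂ → ℂ} {φ : ℂ → ℂ × ℂ} {k : ℂ × ℂ → ℂ × ℂ}
    (hf : Differentiable ℂ f) (hρ : Differentiable ℂ ρ) (hφ : Differentiable ℂ φ)
    (hk : Differentiable ℂ k) (hfk : ∀ z, z = φ (ρ z) + f z • k z) {p : ℂ × ℂ} (hp : f p = 0) :
    fderiv ℂ f p ≠ 0 := by
  intro h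
  have h1 : HasFDerivAt (fun z => φ (ρ z) + f z • k z)
      ((fderiv ℂ φ (ρ p)).comp (fderiv ℂ ρ p) +
        (f p • fderiv ℂ k p + (fderiv ℂ f p).smulRight (k p))) p :=
    ((hφ (ρ p)).hasFDerivAt.comp p (hρ p).hasFDerivAt).add
      ((hf p).hasFDerivAt.smul (hk p).hasFDerivAt)
  have h2 : (fun z => φ (ρ z) + f z • k z) = id := funext fun z => (hfk z).symm
  rw [h2, h, hp] at h1
  have h3 := h1.unique (hasFDerivAt_id p)
  obtain ⟨w, hw0, hw⟩ : ∃ w : ℂ × ℂ, w ≠ 0 ∧ fderiv ℂ ρ p w = 0 := by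
    by_cases h0 : fderiv ℂ ρ p (1, 0) = 0
    · exact ⟨(1, 0), by simp, h0⟩
    · refine ⟨fderiv ℂ ρ p (0, 1) • (1, 0) - fderiv ℂ ρ p (1, 0) • (0, 1), fun h4 => h0 ?_, ?_⟩
      · simpa using congrArg Prod.snd h4
      · rw [map_sub, map_smul, map_smul, smul_eq_mul, smul_eq_mul, mul_comm, sub_self]
  have h5 := congrArg (fun A : ℂ × ℂ →L[ℂ] ℂ × ℂ => A w) h3
  simp [hw] at h5
  exact hw0 h5.symm

theorem exists_root_near {E : Type*} [NormedAddCommGroup E] [NormedSpace ℂ E] {f : E → ℂ}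
    (hf : Differentiable ℂ f) {x : E} (hx : f x ≠ 0) {n : ℕ} (hn : n ≠ 0) :
    ∃ s : E → ℂ, DifferentiableAt ℂ s x ∧ ∀ᶠ z in 𝓝 x, s z ≠ 0 ∧ s z ^ n = f z := by
  obtain ⟨c, hc⟩ := IsAlgClosed.exists_pow_nat_eq (f x) (Nat.pos_of_ne_zero hn)
  refine ⟨fun z => c * (f z / f x) ^ (1 / n : ℂ), ?_, ?_⟩
  · refine DifferentiableAt.const_mul (DifferentiableAt.cpow_const ?_ ?_) c
    · simp only [div_eq_mul_inv]
      exact (hf x).mul_const _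
    · rw [div_self hx]
      exact Complex.one_mem_slitPlane
  · filter_upwards [hf.continuous.continuousAt.eventually_ne hx] with z hz
    have h1 : (c * (f z / f x) ^ (1 / n : ℂ)) ^ n = f z := by
      rw [mul_pow, hc, one_div, Complex.cpow_nat_inv_pow _ hn]
      field_simp
    refine ⟨fun h0 => hz ?_, h1⟩
    rw [← h1, h0, zero_pow hn]

theorem not_exists_retraction {E : Type*} [NormedAddCommGroup E] [NormedSpace ℂ E]
    {m : ℕ} (hm : 1 ≤ m) {f : ℂ × ℂ → ℂ} (hf : Differentiable ℂ f) (hf0 : f 0 ≠ 0)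
    (hdf : ∀ p, f p = 0 → fderiv ℂ f p ≠ 0)
    (hA : ∀ F : ℂ × ℂ → ℂ × ℂ, Differentiable ℂ F → F 0 = 0 →
      fderiv ℂ F 0 = ContinuousLinearMap.id ℂ (ℂ × ℂ) →
      ∃ p, f (F p) = 0 ∧ Function.Surjective (fderiv ℂ F p))
    {Φ : E → (ℂ × ℂ) × (Fin (m + 1) → ℂ) × ℂ} {Ψ : (ℂ × ℂ) × (Fin (m + 1) → ℂ) × ℂ → E}
    (hΦ : Differentiable ℂ Φ) (hΨ : Differentiable ℂ Ψ)
    (hfΦ : ∀ x, f (Φ x).1 = ∏ i, (Φ x).2.1 i)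
    (hΦΨ : ∀ y, f y.1 = ∏ i, y.2.1 i → (∀ i, y.2.1 i ≠ 0) → Φ (Ψ y) = y)
    {r : E → E} (hr : Differentiable ℂ r)
    (hr1 : ∀ x i, (Φ (r x)).2.1 (i + 1) = (Φ (r x)).2.1 i)
    (hr2 : ∀ x, (∀ i, (Φ x).2.1 (i + 1) = (Φ x).2.1 i) → r x = x) : False := by
  have hΦr : Differentiable ℂ fun x => Φ (r x) := hΦ.comp hr
  have hconst : ∀ x i, (Φ (r x)).2.1 i = (Φ (r x)).2.1 0 := by
    intro x i
    induction i using Fin.induction with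
    | zero => rfl
    | succ i ih => rw [← Fin.coeSucc_eq_succ, hr1, ih]
  have hpow : ∀ x, f (Φ (r x)).1 = (Φ (r x)).2.1 0 ^ (m + 1) := by
    intro x
    rw [hfΦ, Finset.prod_congr rfl fun i _ => hconst x i]
    simp
  obtain ⟨s, hs, hsn⟩ := exists_root_near hf hf0 (Nat.succ_ne_zero m)
  have hS : DifferentiableAt ℂ (fun z : ℂ × ℂ => Ψ (z, fun _ => s z, 0)) 0 := by
    refine (hΨ _).comp (0 : ℂ × ℂ)
      (f := fun z : ℂ × ℂ => (z, fun _ : Fin (m + 1) => s z, (0 : ℂ))) ?_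
    refine differentiableAt_id.prodMk (DifferentiableAt.prodMk ?_ (by fun_prop))
    exact differentiableAt_pi.2 fun _ => hs
  set S : ℂ × ℂ → E := fun z => Ψ (z, fun _ => s z, 0) with hSdef
  have hΦS : ∀ᶠ z in 𝓝 (0 : ℂ × ℂ), (Φ (r (S z))).1 = z := by
    filter_upwards [hsn] with z hz
    have h1 : Φ (S z) = (z, fun _ => s z, 0) :=
      hΦΨ _ (by simp [hz.2]) fun _ => hz.1
    rw [hr2 (S z) (by simp [h1]), h1]
  let F : ℂ × ℂ → ℂ × ℂ := fun z => (Φ (r (S 0 + fderiv ℂ S 0 z))).1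
  have hHd : Differentiable ℂ fun x => (Φ (r x)).1 := hΦr.fst
  have hline : Differentiable ℂ fun z => S 0 + fderiv ℂ S 0 z := by fun_prop
  have hF : Differentiable ℂ F := hHd.comp hline
  have hF0 : F 0 = 0 := by simpa [F] using hΦS.self_of_nhds
  have hF1 : fderiv ℂ F 0 = ContinuousLinearMap.id ℂ (ℂ × ℂ) := by
    have h1 : HasFDerivAt (fun z => (Φ (r (S z))).1)
        ((fderiv ℂ (fun x => (Φ (r x)).1) (S 0)).comp (fderiv ℂ S 0)) 0 :=
      (hHd (S 0)).hasFDerivAt.comp (0 : ℂ × ℂ) hS.hasFDerivAt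
    have h2 := h1.unique ((hasFDerivAt_id (0 : ℂ × ℂ)).congr_of_eventuallyEq hΦS)
    rw [← h2]
    have h3 : HasFDerivAt (fun z => S 0 + fderiv ℂ S 0 z) (fderiv ℂ S 0) 0 :=
      (fderiv ℂ S 0).hasFDerivAt.const_add _
    have h4 : HasFDerivAt (fun x => (Φ (r x)).1) (fderiv ℂ (fun x => (Φ (r x)).1) (S 0))
        (S 0 + fderiv ℂ S 0 0) := by
      rw [map_zero, add_zero]
      exact (hHd (S 0)).hasFDerivAt
    exact (h4.comp (0 : ℂ × ℂ) h3).fderiv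
  obtain ⟨p, hp, hsurj⟩ := hA F hF hF0 hF1
  refine hdf _ hp ?_
  let g : ℂ × ℂ → ℂ := fun z => (Φ (r (S 0 + fderiv ℂ S 0 z))).2.1 0
  have hg : Differentiable ℂ g :=
    ((differentiable_pi.1 hΦr.snd.fst 0).comp hline)
  have hfg : (fun z => f (F z)) = fun z => g z ^ (m + 1) := funext fun z => hpow _
  have hgp : g p = 0 := by
    have := congrFun hfg p
    rw [hp] at this
    exact pow_eq_zero_iff (Nat.succ_ne_zero m) |>.1 this.symm
  have h1 : HasFDerivAt (fun z => f (F z)) ((fderiv ℂ f (F p)).comp (fderiv ℂ F p)) p :=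
    (hf (F p)).hasFDerivAt.comp p (hF p).hasFDerivAt
  rw [hfg] at h1
  have h2 := h1.unique ((hg p).hasFDerivAt.pow (m + 1))
  refine ContinuousLinearMap.ext fun w => ?_
  obtain ⟨w, rfl⟩ := hsurj w
  have h3 := congrArg (fun A : ℂ × ℂ →L[ℂ] ℂ => A w) h2
  simpa [hgp, show m ≠ 0 by omega] using h3

/-- The cyclic shift of the middle coordinates. -/
def cyclicShift {m : ℕ} (y : (ℂ × ℂ) × (Fin (m + 1) → ℂ) × ℂ) :
    (ℂ × ℂ) × (Fin (m + 1) → ℂ) × ℂ :=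
  (y.1, fun i => y.2.1 (i + 1), y.2.2)

theorem differentiable_cyclicShift {m : ℕ} : Differentiable ℂ (cyclicShift (m := m)) := by
  unfold cyclicShift
  fun_prop

theorem prod_cyclicShift {m : ℕ} (y : (ℂ × ℂ) × (Fin (m + 1) → ℂ) × ℂ) :
    ∏ i, (cyclicShift y).2.1 i = ∏ i, y.2.1 i :=
  Fintype.prod_equiv (Equiv.addRight 1) _ _ fun _ => rfl

theorem cyclicShift_iterate {m : ℕ} (j : ℕ) (y : (ℂ × ℂ) × (Fin (m + 1) → ℂ) × ℂ) :
    cyclicShift^[j] y = (y.1, fun i => y.2.1 (i + Fin.ofNat (m + 1) j), y.2.2) := by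
  induction j with
  | zero => simp
  | succ j ih =>
    have h : Fin.ofNat (m + 1) (j + 1) = 1 + Fin.ofNat (m + 1) j := by
      ext
      simp [Fin.val_add, add_comm]
    rw [Function.iterate_succ_apply', ih]
    simp only [cyclicShift]
    refine congrArg (fun u => (y.1, u, y.2.2)) (funext fun i => ?_)
    rw [h, add_assoc]

theorem semiconj_cyclicShift {E : Type*} [NormedAddCommGroup E] [NormedSpace ℂ E]
    {m : ℕ} {f : ℂ × ℂ → ℂ} (hf : Differentiable ℂ f) (hf0 : f 0 ≠ 0)
    {Φ : E → (ℂ × ℂ) × (Fin (m + 1) → ℂ) × ℂ} {Ψ : (ℂ × ℂ) × (Fin (m + 1) → ℂ) × ℂ → E}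
    (hΦ : Differentiable ℂ Φ) (hΨ : Differentiable ℂ Ψ)
    (hfΦ : ∀ x, f (Φ x).1 = ∏ i, (Φ x).2.1 i)
    (hΦΨ : ∀ y, f y.1 = ∏ i, y.2.1 i → (∀ i, y.2.1 i ≠ 0) → Φ (Ψ y) = y) :
    Function.Semiconj Φ (fun x => Ψ (cyclicShift (Φ x))) cyclicShift := by
  have hh : Differentiable ℂ fun x => f (Φ x).1 := hf.comp hΦ.fst
  obtain ⟨s, -, hs⟩ := exists_root_near hf hf0 (Nat.succ_ne_zero m)
  obtain ⟨hs0, hs⟩ := hs.self_of_nhds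
  have h0 : f (Φ (Ψ (0, fun _ => s 0, 0))).1 ≠ 0 := by
    rw [hΦΨ (0, fun _ => s 0, 0) (by simp [hs]) fun _ => hs0]
    exact hf0
  have hσΦ := differentiable_cyclicShift.comp hΦ
  refine congrFun (eq_of_eq_of_ne_zero hh h0
    (hΦ.comp (hΨ.comp hσΦ)).continuous hσΦ.continuous fun x hx => ?_)
  refine hΦΨ _ ?_ fun i => ?_
  · rw [prod_cyclicShift]
    exact hfΦ x
  · rw [hfΦ] at hx
    exact Finset.prod_ne_zero_iff.1 hx _ (Finset.mem_univ _)

/-- A linearizable map of finite order admits a holomorphic retraction onto its fixed points. -/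
theorem exists_retraction_of_linearizable {E : Type*} [NormedAddCommGroup E] [NormedSpace ℂ E]
    {F ψ ψinv : E → E} {L : E ≃L[ℂ] E} {n : ℕ} (hn : n ≠ 0) (hF : F^[n] = id)
    (hψ : Differentiable ℂ ψ) (hψinv : Differentiable ℂ ψinv) (h1 : ∀ z, ψinv (ψ z) = z)
    (h2 : ∀ z, ψ (ψinv z) = z) (hL : F = fun z => ψinv (L (ψ z))) :
    ∃ r : E → E, Differentiable ℂ r ∧ (∀ x, F (r x) = r x) ∧ ∀ x, F x = x → r x = x := by
  have hsemi : Function.Semiconj ψ F L := by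
    intro x
    rw [hL]
    exact h2 _
  let A : E →L[ℂ] E := L
  have hA : ∀ (i : ℕ) (w : E), (A ^ i) w = A^[i] w := by
    intro i w
    induction i generalizing w with
    | zero => simp
    | succ i ih => rw [pow_succ, mul_apply_eq_comp, ih, Function.iterate_succ_apply]
  have hLn : A ^ n = 1 := by
    refine ContinuousLinearMap.ext fun w => ?_
    have h3 := (hsemi.iterate_right n) (ψinv w)
    rw [hF, id, h2] at h3
    rw [hA]
    exact h3.symm
  let π : E →L[ℂ] E := (n : ℂ)⁻¹ • ∑ i ∈ Finset.range n, A ^ i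
  have hAπ : ∀ w, A (π w) = π w := by
    have : A * π = π := by
      simp only [π]
      rw [mul_smul_comm, Finset.mul_sum]
      congr 1
      have h3 := Finset.sum_range_succ (fun i => A ^ i) n
      rw [Finset.sum_range_succ', hLn, pow_zero] at h3
      simpa only [pow_succ'] using add_right_cancel h3
    intro w
    exact congrArg (fun B : E →L[ℂ] E => B w) this
  refine ⟨fun x => ψinv (π (ψ x)), hψinv.comp (π.differentiable.comp hψ), fun x => ?_,
    fun x hx => ?_⟩
  · rw [hL]
    dsimp only
    rw [h2]
    exact congrArg ψinv (hAπ _)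
  · have h3 : A (ψ x) = ψ x := by
      have := hsemi x
      rw [hx] at this
      exact this.symm
    have h4 : ∀ i : ℕ, (A ^ i) (ψ x) = ψ x := fun i => by rw [hA, Function.iterate_fixed h3]
    have h5 : π (ψ x) = ψ x := by
      simp only [π, smul_apply, sum_apply, h4]
      simp [← Nat.cast_smul_eq_nsmul ℂ, smul_smul, hn]
    dsimp only
    rw [h5, h1]

theorem exists_periodic_without_retraction {m : ℕ} (hm : 1 ≤ m) :
    ∃ F : (Fin m → ℂ) × ℂ × ℂ × ℂ → (Fin m → ℂ) × ℂ × ℂ × ℂ, Differentiable ℂ F ∧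
      F^[m + 1] = id ∧ (∀ j, 1 ≤ j → j < m + 1 → F^[j] ≠ id) ∧
      ¬ ∃ r : (Fin m → ℂ) × ℂ × ℂ × ℂ → (Fin m → ℂ) × ℂ × ℂ × ℂ, Differentiable ℂ r ∧
        (∀ x, F (r x) = r x) ∧ ∀ x, F x = x → r x = x := by
  obtain ⟨e, δ, he, hδ, hlim, hA⟩ := exists_unavoidable_sequence
  obtain ⟨f, ρ, φ, k, hf, hρ, hφ, hk, hfφ, hρφ, hfk, hf0, hf1, hz⟩ :=
    exists_embedded_line_near he hδ hlim
  obtain ⟨Φ, Ψ, hΦ, hΨ, hΨΦ, hfΦ, hΦΨ⟩ := exists_parametrization m hf hρ hφ hk hfφ hρφ hfk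
  have hsemi := semiconj_cyclicShift hf hf0 hΦ hΨ hfΦ hΦΨ
  refine ⟨fun x => Ψ (cyclicShift (Φ x)), hΨ.comp (differentiable_cyclicShift.comp hΦ), ?_, ?_, ?_⟩
  · funext x
    rw [← hΨΦ ((fun x => Ψ (cyclicShift (Φ x)))^[m + 1] x), hsemi.iterate_right (m + 1) x,
      cyclicShift_iterate]
    simp [hΨΦ]
  · intro j hj1 hj hid
    let y : (ℂ × ℂ) × (Fin (m + 1) → ℂ) × ℂ := (0, fun i => if i = 0 then f 0 else 1, 0)
    have hy : Φ (Ψ y) = y := by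
      refine hΦΨ _ ?_ fun i => ?_
      · simp [y]
      · simp only [y]
        split_ifs
        · exact hf0
        · exact one_ne_zero
    have h1 := hsemi.iterate_right j (Ψ y)
    rw [hid, id, hy, cyclicShift_iterate] at h1
    have h2 := congrFun (congrArg (fun y => y.2.1) h1) 0
    have hj0 : Fin.ofNat (m + 1) j ≠ 0 := by
      intro h
      have h3 := congrArg Fin.val h
      rw [Fin.val_ofNat, Nat.mod_eq_of_lt hj, Fin.val_zero] at h3
      omega
    simp only [y, zero_add, hj0, if_true, if_false] at h2
    exact hf1 h2
  · rintro ⟨r, hr, hr1, hr2⟩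
    refine not_exists_retraction hm hf hf0
      (fun p hp => fderiv_ne_zero_of_embedded_line hf hρ hφ hk hfk hp) ?_ hΦ hΨ hfΦ hΦΨ hr ?_ ?_
    · intro G hG hG0 hG1
      choose e' he' hfe' using hz
      obtain ⟨j, p, hp, hsurj⟩ := hA G hG hG0 hG1 e' he'
      exact ⟨p, by rw [hp, hfe'], hsurj⟩
    · intro x i
      have h1 := hsemi (r x)
      rw [hr1] at h1
      exact (congrFun (congrArg (fun y => y.2.1) h1) i).symm
    · intro x hx
      refine hr2 x ?_
      have : cyclicShift (Φ x) = Φ x := Prod.ext rfl (Prod.ext (funext hx) rfl)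
      dsimp only
      rw [this, hΨΦ]

end

/-- Derksen–Kutzschebauch: for every n ≥ 2 there is a nonlinearizable holomorphic
automorphism of ℂ^{n+2} of period n: F^∘n = id, F^∘m ≠ id for 1 ≤ m < n, and F is not
conjugate by any holomorphic automorphism to an invertible ℂ-linear map. -/
theorem exists_nonlinearizable_periodic_automorphism (n : ℕ) (hn : 2 ≤ n) :
    ∃ F : EuclideanSpace ℂ (Fin (n + 2)) → EuclideanSpace ℂ (Fin (n + 2)),
      IsHolomorphicAutomorphism F ∧
      F^[n] = id ∧
      (∀ m : ℕ, 1 ≤ m → m < n → F^[m] ≠ id) ∧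
      ∀ ψ ψinv : EuclideanSpace ℂ (Fin (n + 2)) → EuclideanSpace ℂ (Fin (n + 2)),
        Differentiable ℂ ψ → Differentiable ℂ ψinv →
        (∀ z, ψinv (ψ z) = z) → (∀ z, ψ (ψinv z) = z) →
        ∀ L : EuclideanSpace ℂ (Fin (n + 2)) ≃L[ℂ] EuclideanSpace ℂ (Fin (n + 2)),
          F ≠ fun z => ψinv (L (ψ z)) := by
  obtain ⟨m, rfl⟩ : ∃ m, n = m + 1 := ⟨n - 1, by omega⟩
  obtain ⟨F, hF, hFn, hFj, hr⟩ := exists_periodic_without_retraction (m := m) (by omega)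
  let l : EuclideanSpace ℂ (Fin (m + 1 + 2)) ≃L[ℂ] (Fin m → ℂ) × ℂ × ℂ × ℂ :=
    ContinuousLinearEquiv.ofFinrankEq (by simp)
  have hsemi : Function.Semiconj l (fun x => l.symm (F (l x))) F := fun x => by simp
  have hiter : ∀ j x, (fun x => l.symm (F (l x)))^[j] x = l.symm (F^[j] (l x)) := by
    intro j x
    rw [← hsemi.iterate_right j x, l.symm_apply_apply]
  have hFd : Differentiable ℂ fun x => l.symm (F (l x)) :=
    l.symm.differentiable.comp (hF.comp l.differentiable)
  have hFn' : (fun x => l.symm (F (l x)))^[m + 1] = id := funext fun x => by rw [hiter, hFn]; simp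
  refine ⟨fun x => l.symm (F (l x)), ⟨hFd, (fun x => l.symm (F (l x)))^[m], hFd.iterate m,
    fun z => ?_, fun z => ?_⟩, hFn', fun j h1 h2 h3 => hFj j h1 h2 ?_, ?_⟩
  · exact (Function.iterate_succ_apply _ m z).symm.trans (congrFun hFn' z)
  · exact (Function.iterate_succ_apply' _ m z).symm.trans (congrFun hFn' z)
  · funext x
    have := hiter j (l.symm x)
    rw [h3] at this
    simpa using this.symm
  · intro ψ ψinv hψ hψinv h1 h2 L hL
    obtain ⟨r, hrd, hr1, hr2⟩ :=
      exists_retraction_of_linearizable (Nat.succ_ne_zero m) hFn' hψ hψinv h1 h2 hL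
    refine hr ⟨fun x => l (r (l.symm x)), l.differentiable.comp (hrd.comp l.symm.differentiable),
      fun x => ?_, fun x hx => ?_⟩
    · exact (hsemi (r (l.symm x))).symm.trans (congrArg l (hr1 _))
    · dsimp only
      rw [hr2 _ (by simp [hx]), l.apply_symm_apply]
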